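/- arXiv:1803.02415 — 11 statements merged into one kernel-verified Lean document; each statement's English description precedes it below -/
import Mathlib

section
/- Let Q : ℝ^m × ℝ^d → ℝ be continuously differentiable, let P be a probability measure on ℝ^d that is absolutely continuous with respect to Lebesgue measure, and let Z ⊆ ℝ^d be measurable with P(Z) = 1. Suppose that for every pair of distinct points t, s ∈ ℝ^m and every z ∈ Z, at least one of the following holds: (a) Q(t,z) ≠ Q(s,z); (b) the gradient of Q in its first argument at (t,z) is nonzero; (c) the gradient of Q in its first argument at (s,z) is nonzero; (d) ∇_z Q(t,z) ≠ ∇_z Q(s,z). Then the set of z ∈ Z for which the function t ↦ Q(t,z) has two or more global minimizers over ℝ^m is contained in a P-null set. -/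
open MeasureTheory Metric Topology

section

variable {T E : Type*} [NormedAddCommGroup T] [NormedAddCommGroup E]

/-- The triples `(t, s, z)` such that both `t` and `s` are global minimizers of `Q · z`. -/
def minimizerTriples (Q : T → E → ℝ) : Set (T × T × E) :=
  {p | ∀ t', Q p.1 p.2.2 ≤ Q t' p.2.2 ∧ Q p.2.1 p.2.2 ≤ Q t' p.2.2}

theorem isClosed_minimizerTriples {Q : T → E → ℝ} (hQ : Continuous fun p : T × E => Q p.1 p.2) :
    IsClosed (minimizerTriples Q) := by
  have h {X : Type _} [TopologicalSpace X] {a : X → T} {b : X → E} (ha : Continuous a)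
      (hb : Continuous b) : Continuous fun x => Q (a x) (b x) := hQ.comp (ha.prodMk hb)
  simp only [minimizerTriples, Set.ofPred_forall]
  refine isClosed_iInter fun t' => ?_
  exact (isClosed_le (h (by fun_prop) (by fun_prop)) (h (by fun_prop) (by fun_prop))).inter
    (isClosed_le (h (by fun_prop) (by fun_prop)) (h (by fun_prop) (by fun_prop)))

variable [NormedSpace ℝ E]

/-- If `Q t - Q s` increases in the direction `v` for all `t`, `s` in a ball, then two values of the
parameter which have minimizers in the ball cannot be translates of each other along `v`. -/
theorem add_smul_notMem_image_minimizerTriples {Q : T → E → ℝ}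
    (hQ : ∀ t, Differentiable ℝ (Q t)) {p : T × T × E} {r : ℝ} {v : E}
    (hv : ∀ q ∈ closedBall p r, fderiv ℝ (Q q.2.1) q.2.2 v < fderiv ℝ (Q q.1) q.2.2 v)
    {z : E} (hz : z ∈ (fun q => q.2.2) '' (closedBall p r ∩ minimizerTriples Q))
    {h : ℝ} (hh : 0 < h) :
    z + h • v ∉ (fun q => q.2.2) '' (closedBall p r ∩ minimizerTriples Q) := by
  rintro ⟨⟨t₂, s₂, z₂⟩, ⟨hb₂, hm₂⟩, rfl : z₂ = _⟩
  obtain ⟨⟨t₁, s₁, z₁⟩, ⟨hb₁, hm₁⟩, rfl : z₁ = _⟩ := hz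
  simp only [mem_closedBall, Prod.dist_eq, sup_le_iff] at hb₁ hb₂ hv
  have hd : Differentiable ℝ fun z => Q t₂ z - Q s₁ z := (hQ t₂).sub (hQ s₁)
  obtain ⟨w, hw, hwd⟩ := domain_mvt (s := Set.univ) (x := z₁) (y := z₁ + h • v)
    (fun x _ => (hd x).hasFDerivAt.hasFDerivWithinAt) convex_univ trivial trivial
  have hwb : w ∈ closedBall p.2.2 r :=
    (convex_closedBall _ _).segment_subset (mem_closedBall.2 hb₁.2.2) (mem_closedBall.2 hb₂.2.2) hw
  have hpos := hv (t₂, s₁, w) ⟨hb₂.1, hb₁.2.1, hwb⟩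
  rw [fderiv_fun_sub (hQ _ _) (hQ _ _), add_sub_cancel_left, map_smul, smul_eq_mul,
    sub_apply] at hwd
  have := mul_pos hh (sub_pos.2 hpos)
  have h₁ := (hm₁ t₂).2
  have h₂ := (hm₂ s₁).1
  dsimp only at h₁ h₂
  linarith

variable [NormedSpace ℝ T]

theorem continuous_fderiv_right {Q : T → E → ℝ} (hQ : ContDiff ℝ 1 fun p : T × E => Q p.1 p.2) :
    Continuous fun p : T × E => fderiv ℝ (Q p.1) p.2 := by
  have h (p : T × E) : fderiv ℝ (Q p.1) p.2 =
      (fderiv ℝ (fun p : T × E => Q p.1 p.2) p).comp (ContinuousLinearMap.inr ℝ T E) :=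
    (HasFDerivAt.comp (g := fun p : T × E => Q p.1 p.2) (f := fun z => (p.1, z)) p.2
      (hQ.differentiable one_ne_zero p).hasFDerivAt (hasFDerivAt_prodMk_right p.1 p.2)).fderiv
  simp only [h]
  exact (hQ.continuous_fderiv one_ne_zero).clm_comp continuous_const

variable [FiniteDimensional ℝ T] [FiniteDimensional ℝ E] [MeasurableSpace E] [BorelSpace E]

theorem exists_nhds_measure_image_minimizerTriples_eq_zero (μ : Measure E) [μ.IsAddHaarMeasure]
    {Q : T → E → ℝ} (hQ : ContDiff ℝ 1 fun p : T × E => Q p.1 p.2) {p : T × T × E}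
    (hp : fderiv ℝ (Q p.1) p.2.2 ≠ fderiv ℝ (Q p.2.1) p.2.2) :
    ∃ W ∈ 𝓝 p, μ ((fun q => q.2.2) '' (W ∩ minimizerTriples Q)) = 0 := by
  have := FiniteDimensional.proper_real T
  have := FiniteDimensional.proper_real E
  obtain ⟨v, hv⟩ : ∃ v, fderiv ℝ (Q p.2.1) p.2.2 v < fderiv ℝ (Q p.1) p.2.2 v := by
    by_contra! hle
    refine hp (ContinuousLinearMap.ext fun v => (hle v).antisymm ?_)
    simpa using hle (-v)
  have hc := continuous_fderiv_right hQ
  have hopen : IsOpen {q : T × T × E |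
      fderiv ℝ (Q q.2.1) q.2.2 v < fderiv ℝ (Q q.1) q.2.2 v} :=
    isOpen_lt ((hc.comp (continuous_snd.fst.prodMk continuous_snd.snd)).clm_apply continuous_const)
      ((hc.comp (continuous_fst.prodMk continuous_snd.snd)).clm_apply continuous_const)
  obtain ⟨r, hr, hball⟩ := nhds_basis_closedBall.mem_iff.1 (hopen.mem_nhds hv)
  refine ⟨closedBall p r, closedBall_mem_nhds p hr, ?_⟩
  set S := (fun q : T × T × E => q.2.2) '' (closedBall p r ∩ minimizerTriples Q)
  have hScompact : IsCompact S :=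
    ((isCompact_closedBall p r).inter_right (isClosed_minimizerTriples hQ.continuous)).image
      continuous_snd.snd
  have hQd (t : T) : Differentiable ℝ (Q t) :=
    (hQ.differentiable one_ne_zero).comp ((differentiable_const t).prodMk differentiable_id)
  have hlim : Filter.Tendsto (fun n : ℕ => (1 / ((n : ℝ) + 1)) • v) Filter.atTop (𝓝 ((0 : ℝ) • v)) :=
    tendsto_one_div_add_atTop_nhds_zero_nat.smul_const v
  refine Measure.addHaar_eq_zero_of_disjoint_translates μ
    (fun n : ℕ => (1 / ((n : ℝ) + 1)) • v) (isBounded_range_of_tendsto _ hlim) ?_ hScompact.measurableSet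
  refine (pairwise_disjoint_on _).2 fun i j hij => Set.disjoint_left.2 ?_
  simp only [Set.singleton_add, Set.mem_image]
  rintro _ ⟨z, hz, rfl⟩ ⟨w, hw, hzw⟩
  have hlt : (1 : ℝ) / (j + 1) < 1 / (i + 1) := Nat.one_div_lt_one_div hij
  refine add_smul_notMem_image_minimizerTriples hQd hball hz (sub_pos.2 hlt) ?_
  have hwz : w = z + ((1 : ℝ) / (i + 1) - 1 / (j + 1)) • v := by
    rw [sub_smul, ← sub_eq_zero]
    rw [← sub_eq_zero] at hzw
    rw [← hzw]
    abel
  rwa [← hwz]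

/-- Almost every parameter `z` has the property that all the global minimizers `t` of `Q · z` share
the same derivative of `Q t` at `z`. -/
theorem measure_image_minimizerTriples_fderiv_ne_eq_zero (μ : Measure E) [μ.IsAddHaarMeasure]
    {Q : T → E → ℝ} (hQ : ContDiff ℝ 1 fun p : T × E => Q p.1 p.2) :
    μ ((fun q => q.2.2) '' (minimizerTriples Q ∩
      {p | fderiv ℝ (Q p.1) p.2.2 ≠ fderiv ℝ (Q p.2.1) p.2.2})) = 0 := by
  have := FiniteDimensional.proper_real T
  have := FiniteDimensional.proper_real E
  choose! W hW hW0 using fun (p : T × T × E)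
    (hp : fderiv ℝ (Q p.1) p.2.2 ≠ fderiv ℝ (Q p.2.1) p.2.2) =>
      exists_nhds_measure_image_minimizerTriples_eq_zero μ hQ hp
  obtain ⟨C, hCs, hC, hcover⟩ := TopologicalSpace.countable_cover_nhdsWithin
    (s := {p : T × T × E | fderiv ℝ (Q p.1) p.2.2 ≠ fderiv ℝ (Q p.2.1) p.2.2})
    fun p hp => mem_nhdsWithin_of_mem_nhds (hW p hp)
  refine measure_mono_null ?_ ((measure_biUnion_null_iff hC).2 fun p hp => hW0 p (hCs hp))
  rintro _ ⟨q, ⟨hqm, hq⟩, rfl⟩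
  obtain ⟨p, hp, hqp⟩ := Set.mem_iUnion₂.1 (hcover hq)
  exact Set.mem_iUnion₂.2 ⟨p, hp, q, ⟨hqp, hqm⟩, rfl⟩

end

/-- Euclidean special case of Lemma 1: under joint continuous
differentiability of `Q` and the genericity condition, the set of realizations `z ∈ Z`
for which `t ↦ Q t z` has two or more global minimizers over `ℝ^m` is contained in a
`P`-null set. -/
theorem almost_sure_uniqueness_euclidean (m d : ℕ)
    (Q : (Fin m → ℝ) → (Fin d → ℝ) → ℝ)
    (hQ : ContDiff ℝ 1 (fun p : (Fin m → ℝ) × (Fin d → ℝ) => Q p.1 p.2))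
    (P : Measure (Fin d → ℝ)) [IsProbabilityMeasure P]
    (hP : P ≪ volume)
    (Z : Set (Fin d → ℝ)) (hZm : MeasurableSet Z) (hZ1 : P Z = 1)
    (hgen : ∀ t s : Fin m → ℝ, t ≠ s → ∀ z ∈ Z,
      Q t z ≠ Q s z ∨
      fderiv ℝ (fun t' => Q t' z) t ≠ 0 ∨
      fderiv ℝ (fun t' => Q t' z) s ≠ 0 ∨
      fderiv ℝ (fun z' => Q t z') z ≠ fderiv ℝ (fun z' => Q s z') z) :
    ∃ N : Set (Fin d → ℝ),
      {z ∈ Z | ∃ t s : Fin m → ℝ, t ≠ s ∧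
        (∀ t' : Fin m → ℝ, Q t z ≤ Q t' z) ∧ (∀ t' : Fin m → ℝ, Q s z ≤ Q t' z)} ⊆ N ∧
      MeasurableSet N ∧ P N = 0 := by
  obtain ⟨N, hN, hNm, hN0⟩ := exists_measurable_superset_of_null
    (hP (measure_image_minimizerTriples_fderiv_ne_eq_zero volume hQ))
  refine ⟨N, ?_, hNm, hN0⟩
  rintro z ⟨hz, t, s, hts, ht, hs⟩
  have hcrit {a : Fin m → ℝ} (ha : ∀ t', Q a z ≤ Q t' z) : fderiv ℝ (fun t' => Q t' z) a = 0 :=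
    IsLocalMin.fderiv_eq_zero (Filter.Eventually.of_forall ha)
  refine hN ⟨(t, s, z), ⟨fun t' => ⟨ht t', hs t'⟩, ?_⟩, rfl⟩
  rcases hgen t s hts z hz with h | h | h | h
  · exact absurd ((ht s).antisymm (hs t)) h
  · exact absurd (hcrit ht) h
  · exact absurd (hcrit hs) h
  · exact h
end

section
/- Let J be a finite or countable index set and for each j ∈ J let T_j ⊆ ℝ^m be locally compact in its subspace topology (every point of T_j has a compact neighborhood within T_j); set T = ⋃_{j∈J} T_j. Let Q : T × ℝ^d → ℝ be such that, for each j ∈ J, Q is jointly continuous on T_j × ℝ^d, for each t ∈ T the map z ↦ Q(t,z) is differentiable on ℝ^d, and (t,z) ↦ ∇_z Q(t,z) is jointly continuous on T_j × ℝ^d. Let P be a probability measure on ℝ^d absolutely continuous with respect to Lebesgue measure and Z ⊆ ℝ^d measurable with P(Z) = 1. Suppose that for all distinct t, s ∈ T and all z ∈ Z, either Q(t,z) ≠ Q(s,z) or ∇_z Q(t,z) ≠ ∇_z Q(s,z). Then the set of z ∈ Z for which the function t ↦ Q(t,z) has two or more global minimizers over T is contained in a P-null set. -/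
open MeasureTheory

/-- A real function has vanishing derivative at almost every point of its zero set at which it is
differentiable. -/
theorem ae_fderiv_eq_zero_of_eq_zero {E : Type*} [NormedAddCommGroup E] [NormedSpace ℝ E]
    [FiniteDimensional ℝ E] [MeasurableSpace E] [BorelSpace E] (μ : Measure E) [μ.IsAddHaarMeasure]
    {h : E → ℝ} (hh : Measurable h) :
    ∀ᵐ x ∂μ, h x = 0 → DifferentiableAt ℝ h x → fderiv ℝ h x = 0 := by
  rcases subsingleton_or_nontrivial E with hE | hE
  · exact Filter.Eventually.of_forall fun x _ _ => Subsingleton.elim _ _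
  obtain ⟨v, hv⟩ := exists_ne (0 : E)
  have hs : MeasurableSet ({x | h x = 0} ∩ {x | DifferentiableAt ℝ h x}) :=
    (hh (measurableSet_singleton 0)).inter (measurableSet_of_differentiableAt ℝ h)
  have happ : ApproximatesLinearOn (fun x => h x • v) (0 : E →L[ℝ] E)
      ({x | h x = 0} ∩ {x | DifferentiableAt ℝ h x}) 0 := by
    rintro x ⟨hx, -⟩ y ⟨hy, -⟩
    simp only [Set.mem_ofPred_eq] at hx hy
    simp [hx, hy]
  have hae := happ.norm_fderiv_sub_le μ hs (fun x => (fderiv ℝ h x).smulRight v)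
    fun x hx => (hx.2.hasFDerivAt.smul_const v).hasFDerivWithinAt
  rw [ae_restrict_iff' hs] at hae
  filter_upwards [hae] with x hx h0 hd
  simpa [hv] using hx ⟨h0, hd⟩

/-- The pointwise minimum over a compact parameter set of a `C¹` family of functions is Lipschitz
on bounded sets. -/
theorem exists_lipschitzWith_isLeast_image {X E : Type*} [TopologicalSpace X]
    [NormedAddCommGroup E] [NormedSpace ℝ E] [ProperSpace E] {K : Set X} (hK : IsCompact K)
    (hne : K.Nonempty) {q : X → E → ℝ}
    (hcont : ∀ z, ContinuousOn (fun t => q t z) K)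
    (hdiff : ∀ t ∈ K, Differentiable ℝ (q t))
    (hgrad : ContinuousOn (fun p : X × E => fderiv ℝ (q p.1) p.2) (K ×ˢ Set.univ)) (R : ℝ) :
    ∃ C F, LipschitzWith C F ∧
      ∀ z ∈ Metric.closedBall (0 : E) R, IsLeast ((fun t => q t z) '' K) (F z) := by
  choose f hf using fun z => (hK.image_of_continuousOn (hcont z)).exists_isLeast (hne.image _)
  obtain ⟨C, hC⟩ := (hK.prod (isCompact_closedBall (0 : E) R)).exists_bound_of_continuousOn
    (hgrad.mono (Set.prod_mono le_rfl (Set.subset_univ _)))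
  have hlip : LipschitzOnWith C.toNNReal f (Metric.closedBall 0 R) := by
    refine LipschitzOnWith.of_le_add_mul' C fun x hx y hy => ?_
    obtain ⟨t, ht, hty⟩ := (hf y).1
    have hle : f x ≤ q t x := (hf x).2 ⟨t, ht, rfl⟩
    have hmv := (convex_closedBall (0 : E) R).norm_image_sub_le_of_norm_fderiv_le
      (fun z _ => hdiff t ht z) (fun z hz => hC (t, z) ⟨ht, hz⟩) hy hx
    rw [← dist_eq_norm x y] at hmv
    have := (le_abs_self _).trans hmv
    simp only at hty
    linarith
  obtain ⟨F, hF, heq⟩ := hlip.extend_real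
  exact ⟨_, F, hF, fun z hz => heq hz ▸ hf z⟩

/-- At a point where a family of functions has a minimizer, the derivative of the minimum function
is the derivative of the minimizing member. -/
theorem fderiv_eq_of_isLeast_image {X E : Type*} [NormedAddCommGroup E] [NormedSpace ℝ E]
    {K : Set X} {q : X → E → ℝ} {F : E → ℝ} {z : E} {t : X} (ht : t ∈ K)
    (hF : ∀ᶠ w in nhds z, IsLeast ((fun t => q t w) '' K) (F w)) (heq : F z = q t z)
    (hFd : DifferentiableAt ℝ F z) (hqd : DifferentiableAt ℝ (q t) z) :
    fderiv ℝ F z = fderiv ℝ (q t) z := by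
  have hmin : IsLocalMin (q t - F) z := by
    filter_upwards [hF] with w hw
    have : F w ≤ q t w := hw.2 ⟨t, ht, rfl⟩
    simp only [Pi.sub_apply]
    linarith
  have h0 := hmin.fderiv_eq_zero
  rw [fderiv_sub hqd hFd, sub_eq_zero] at h0
  exact h0.symm

/-- For two compact `C¹` families of functions, at almost every point where the two minima agree
all minimizers have the same derivative. -/
theorem ae_fderiv_eq_of_minimizers {X E : Type*} [TopologicalSpace X]
    [NormedAddCommGroup E] [NormedSpace ℝ E] [FiniteDimensional ℝ E] [MeasurableSpace E]
    [BorelSpace E] (μ : Measure E) [μ.IsAddHaarMeasure] {K L : Set X} (hK : IsCompact K)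
    (hL : IsCompact L) {q : X → E → ℝ}
    (hKcont : ∀ z, ContinuousOn (fun t => q t z) K)
    (hLcont : ∀ z, ContinuousOn (fun t => q t z) L)
    (hKdiff : ∀ t ∈ K, Differentiable ℝ (q t)) (hLdiff : ∀ t ∈ L, Differentiable ℝ (q t))
    (hKgrad : ContinuousOn (fun p : X × E => fderiv ℝ (q p.1) p.2) (K ×ˢ Set.univ))
    (hLgrad : ContinuousOn (fun p : X × E => fderiv ℝ (q p.1) p.2) (L ×ˢ Set.univ)) :
    ∀ᵐ z ∂μ, ∀ t ∈ K, ∀ s ∈ L, (∀ r ∈ K, q t z ≤ q r z) → (∀ r ∈ L, q s z ≤ q r z) →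
      q t z = q s z → fderiv ℝ (q t) z = fderiv ℝ (q s) z := by
  have : ProperSpace E := FiniteDimensional.proper_real E
  rcases K.eq_empty_or_nonempty with rfl | hKne
  · simp
  rcases L.eq_empty_or_nonempty with rfl | hLne
  · simp
  choose C F hF hFmin using exists_lipschitzWith_isLeast_image hK hKne hKcont hKdiff hKgrad
  choose D G hG hGmin using exists_lipschitzWith_isLeast_image hL hLne hLcont hLdiff hLgrad
  have hae : ∀ᵐ z ∂μ, ∀ n : ℕ, DifferentiableAt ℝ (F n) z ∧ DifferentiableAt ℝ (G n) z ∧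
      ((F n - G n) z = 0 → DifferentiableAt ℝ (F n - G n) z → fderiv ℝ (F n - G n) z = 0) := by
    refine ae_all_iff.2 fun n => ?_
    filter_upwards [(hF n).ae_differentiableAt (μ := μ), (hG n).ae_differentiableAt (μ := μ),
      ae_fderiv_eq_zero_of_eq_zero μ
        ((hF n).continuous.sub (hG n).continuous).measurable] with z h1 h2 h3
    exact ⟨h1, h2, h3⟩
  filter_upwards [hae] with z hz t ht s hs htmin hsmin hts
  obtain ⟨n, hn⟩ := exists_nat_gt ‖z‖
  obtain ⟨hFd, hGd, h0⟩ := hz n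
  have hnhds : Metric.closedBall (0 : E) n ∈ nhds z :=
    mem_nhds_iff.2 ⟨_, Metric.ball_subset_closedBall, Metric.isOpen_ball, by simpa using hn⟩
  have hFt : F n z = q t z := (hFmin n z (mem_of_mem_nhds hnhds)).unique
    ⟨⟨t, ht, rfl⟩, Set.forall_mem_image.2 htmin⟩
  have hGs : G n z = q s z := (hGmin n z (mem_of_mem_nhds hnhds)).unique
    ⟨⟨s, hs, rfl⟩, Set.forall_mem_image.2 hsmin⟩
  have hFG := h0 (by simp [hFt, hGs, hts]) (hFd.sub hGd)
  rw [fderiv_sub hFd hGd, sub_eq_zero] at hFG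
  rw [← fderiv_eq_of_isLeast_image ht (Filter.mem_of_superset hnhds (hFmin n)) hFt hFd
      (hKdiff t ht z),
    ← fderiv_eq_of_isLeast_image hs (Filter.mem_of_superset hnhds (hGmin n)) hGs hGd
      (hLdiff s hs z), hFG]

/-- Lemma 1 with genericity via conditions (a) and (d): for `T` a finite
or countable union of locally compact subsets `T j` of `ℝ^m`, under joint continuity of `Q`
and of its `z`-gradient on each piece, and the genericity condition that distinct points
give distinct values or distinct `z`-gradients, the set of `z ∈ Z` with two or more global
minimizers over `T` is contained in a `P`-null set. -/
theorem almost_sure_uniqueness_pieces {J : Type*} [Countable J] (m d : ℕ)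
    (T : J → Set (Fin m → ℝ))
    (hloc : ∀ j, ∀ t ∈ T j, ∃ K : Set (Fin m → ℝ),
      K ⊆ T j ∧ IsCompact K ∧ K ∈ nhdsWithin t (T j))
    (Q : (Fin m → ℝ) → (Fin d → ℝ) → ℝ)
    (hcont : ∀ j, ContinuousOn (fun p : (Fin m → ℝ) × (Fin d → ℝ) => Q p.1 p.2)
      ((T j) ×ˢ (Set.univ : Set (Fin d → ℝ))))
    (hdiff : ∀ t ∈ ⋃ j, T j, Differentiable ℝ (fun z => Q t z))
    (hgradcont : ∀ j, ContinuousOn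
      (fun p : (Fin m → ℝ) × (Fin d → ℝ) => fderiv ℝ (fun z => Q p.1 z) p.2)
      ((T j) ×ˢ (Set.univ : Set (Fin d → ℝ))))
    (P : Measure (Fin d → ℝ)) [IsProbabilityMeasure P] (hP : P ≪ volume)
    (Z : Set (Fin d → ℝ)) (hZm : MeasurableSet Z) (hZ1 : P Z = 1)
    (hgen : ∀ t ∈ ⋃ j, T j, ∀ s ∈ ⋃ j, T j, t ≠ s → ∀ z ∈ Z,
      Q t z ≠ Q s z ∨
      fderiv ℝ (fun z' => Q t z') z ≠ fderiv ℝ (fun z' => Q s z') z) :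
    ∃ N : Set (Fin d → ℝ),
      {z ∈ Z | ∃ t ∈ ⋃ j, T j, ∃ s ∈ ⋃ j, T j, t ≠ s ∧
        (∀ r ∈ ⋃ j, T j, Q t z ≤ Q r z) ∧ (∀ r ∈ ⋃ j, T j, Q s z ≤ Q r z)} ⊆ N ∧
      MeasurableSet N ∧ P N = 0 := by
  choose! K hKT hKc hKn using hloc
  choose A hAT hAc hAcov using fun j => TopologicalSpace.countable_cover_nhdsWithin (hKn j)
  have : ∀ j, Countable (A j) := fun j => (hAc j).to_subtype
  have hKA : ∀ a : Σ j, A j, K a.1 a.2 ⊆ T a.1 := fun a => hKT _ _ (hAT _ a.2.2)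
  have hcover : ∀ t ∈ ⋃ j, T j, ∃ a : Σ j, A j, t ∈ K a.1 a.2 := by
    intro t ht
    obtain ⟨j, hj⟩ := Set.mem_iUnion.1 ht
    obtain ⟨x, hx, hxt⟩ := Set.mem_iUnion₂.1 (hAcov j hj)
    exact ⟨⟨j, x, hx⟩, hxt⟩
  have hKU : ∀ a : Σ j, A j, K a.1 a.2 ⊆ ⋃ j, T j := fun a =>
    (hKA a).trans (Set.subset_iUnion T a.1)
  have hcontK : ∀ (a : Σ j, A j) (z : Fin d → ℝ), ContinuousOn (fun t => Q t z) (K a.1 a.2) :=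
    fun a z => (hcont a.1).comp (f := fun t => (t, z)) (by fun_prop)
      fun t ht => ⟨hKA a ht, Set.mem_univ z⟩
  have hgradK := fun a : Σ j, A j => (hgradcont a.1).mono
    (Set.prod_mono (hKA a) (le_refl Set.univ))
  have hae := ae_all_iff.2 fun a : Σ j, A j => ae_all_iff.2 fun b : Σ j, A j =>
    hP.ae_le (ae_fderiv_eq_of_minimizers volume (hKc _ _ (hAT _ a.2.2)) (hKc _ _ (hAT _ b.2.2))
      (hcontK a) (hcontK b) (fun t ht => hdiff t (hKU a ht)) (fun t ht => hdiff t (hKU b ht))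
      (hgradK a) (hgradK b))
  refine exists_measurable_superset_of_null (measure_mono_null ?_ (ae_iff.1 hae))
  rintro z ⟨hzZ, t, ht, s, hs, hts, htmin, hsmin⟩ hz
  obtain ⟨a, ha⟩ := hcover t ht
  obtain ⟨b, hb⟩ := hcover s hs
  have heq : Q t z = Q s z := le_antisymm (htmin s hs) (hsmin t ht)
  exact (hgen t ht s hs hts z hzZ).elim (fun h => h heq) fun h =>
    h (hz a b t ha s hb (fun r hr => htmin r (hKU a hr)) (fun r hr => hsmin r (hKU b hr)) heq)
end

section
/- Let T be a topological space and let 𝒦 be a countable collection of compact subsets of T such that for any two distinct points t, s ∈ T there exist disjoint sets K, C ∈ 𝒦 with t ∈ K and s ∈ C. Let Q : T × ℝ^d → ℝ, let P be a probability measure on ℝ^d, let Z ⊆ ℝ^d be measurable with P(Z) = 1, and let (Z_k)_{k≥1} be a sequence of compact subsets of Z with P(Z_k) → 1 as k → ∞. Suppose that for every k and every pair of disjoint sets K, C ∈ 𝒦, the set {z ∈ Z_k : V(T,z) = V(K,z) = V(C,z)} is P-null. Then the set of z ∈ Z for which the function t ↦ Q(t,z) has two or more global minimizers over T is contained in a P-null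 set. -/
open MeasureTheory

/-- The value function `V(K,z) = inf_{t ∈ K} Q(t,z)`, with values in the extended reals. -/
noncomputable def valueFn {T : Type*} {d : ℕ} (Q : T → (Fin d → ℝ) → ℝ)
    (K : Set T) (z : Fin d → ℝ) : EReal :=
  ⨅ t ∈ K, ((Q t z : ℝ) : EReal)

/-- The value function over any set containing a global minimizer is the minimal value. -/
theorem valueFn_eq_of_forall_le {T : Type*} {d : ℕ} {Q : T → (Fin d → ℝ) → ℝ} {K : Set T}
    {z : Fin d → ℝ} {t : T} (ht : t ∈ K) (hmin : ∀ r, Q t z ≤ Q r z) :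
    valueFn Q K z = (Q t z : EReal) :=
  le_antisymm (iInf₂_le t ht) (le_iInf₂ fun r _ => EReal.coe_le_coe_iff.2 (hmin r))

/-- A sequence of measurable sets whose probabilities tend to one covers almost every point. -/
theorem measure_compl_iUnion_eq_zero_of_tendsto_one {Ω : Type*} [MeasurableSpace Ω]
    {P : Measure Ω} [IsProbabilityMeasure P] {s : ℕ → Set Ω} (hs : ∀ k, MeasurableSet (s k))
    (h : Filter.Tendsto (fun k => P (s k)) Filter.atTop (nhds 1)) :
    P (⋃ k, s k)ᶜ = 0 :=
  (prob_compl_eq_zero_iff (MeasurableSet.iUnion hs)).2 <|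
    le_antisymm prob_le_one <|
      le_of_tendsto' h fun k => measure_mono (Set.subset_iUnion s k)

/-- Lemma 2: reduction of almost sure uniqueness of the argmin to a
condition on pairs of disjoint compact sets from a countable separating collection. -/
theorem uniqueness_from_compact_pairs {T : Type*} [TopologicalSpace T] (d : ℕ)
    (𝒦 : Set (Set T)) (h𝒦count : 𝒦.Countable) (h𝒦cpt : ∀ K ∈ 𝒦, IsCompact K)
    (hsep : ∀ t s : T, t ≠ s → ∃ K ∈ 𝒦, ∃ C ∈ 𝒦, Disjoint K C ∧ t ∈ K ∧ s ∈ C)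
    (Q : T → (Fin d → ℝ) → ℝ)
    (P : Measure (Fin d → ℝ)) [IsProbabilityMeasure P]
    (Z : Set (Fin d → ℝ)) (hZm : MeasurableSet Z) (hZ1 : P Z = 1)
    (Zk : ℕ → Set (Fin d → ℝ)) (hZkcpt : ∀ k, IsCompact (Zk k)) (hZkZ : ∀ k, Zk k ⊆ Z)
    (hZk1 : Filter.Tendsto (fun k => P (Zk k)) Filter.atTop (nhds 1))
    (hcond : ∀ k : ℕ, ∀ K ∈ 𝒦, ∀ C ∈ 𝒦, Disjoint K C →
      ∃ A : Set (Fin d → ℝ),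
        {z ∈ Zk k | valueFn Q Set.univ z = valueFn Q K z ∧ valueFn Q K z = valueFn Q C z} ⊆ A ∧
        MeasurableSet A ∧ P A = 0) :
    ∃ N : Set (Fin d → ℝ),
      {z ∈ Z | ∃ t s : T, t ≠ s ∧ (∀ r : T, Q t z ≤ Q r z) ∧ (∀ r : T, Q s z ≤ Q r z)} ⊆ N ∧
      MeasurableSet N ∧ P N = 0 := by
  have hpairs : ∀ k, ∀ K ∈ 𝒦, ∀ C ∈ 𝒦, P {z | Disjoint K C ∧ z ∈ Zk k ∧
      valueFn Q Set.univ z = valueFn Q K z ∧ valueFn Q K z = valueFn Q C z} = 0 := by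
    intro k K hK C hC
    by_cases hKC : Disjoint K C
    · obtain ⟨A, hA, -, hPA⟩ := hcond k K hK C hC hKC
      exact measure_mono_null (fun z hz => hA hz.2) hPA
    · simp [hKC]
  have hnull : P ((⋃ k, Zk k)ᶜ ∪ ⋃ k, ⋃ K ∈ 𝒦, ⋃ C ∈ 𝒦, {z | Disjoint K C ∧ z ∈ Zk k ∧
      valueFn Q Set.univ z = valueFn Q K z ∧ valueFn Q K z = valueFn Q C z}) = 0 :=
    measure_union_null
      (measure_compl_iUnion_eq_zero_of_tendsto_one (fun k => (hZkcpt k).measurableSet) hZk1)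
      (measure_iUnion_null fun k => (measure_biUnion_null_iff h𝒦count).2 fun K hK =>
        (measure_biUnion_null_iff h𝒦count).2 fun C hC => hpairs k K hK C hC)
  obtain ⟨N, hN, hNm, hPN⟩ := exists_measurable_superset_of_null hnull
  refine ⟨N, fun z hz => hN ?_, hNm, hPN⟩
  obtain ⟨-, t, s, hts, ht, hs⟩ := hz
  by_cases hzk : z ∈ ⋃ k, Zk k
  · obtain ⟨k, hk⟩ := Set.mem_iUnion.1 hzk
    obtain ⟨K, hK, C, hC, hKC, htK, hsC⟩ := hsep t s hts
    refine Or.inr (Set.mem_iUnion.2 ⟨k, Set.mem_iUnion₂.2 ⟨K, hK, Set.mem_iUnion₂.2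
      ⟨C, hC, hKC, hk, ?_, ?_⟩⟩⟩)
    · rw [valueFn_eq_of_forall_le (Set.mem_univ t) ht, valueFn_eq_of_forall_le htK ht]
    · rw [valueFn_eq_of_forall_le htK ht, valueFn_eq_of_forall_le hsC hs,
        le_antisymm (ht s) (hs t)]
  · exact Or.inl hzk
end

section
/- Let T be a topological space and Q : T × ℝ^d → ℝ be jointly continuous. Let t, s ∈ T and z̄ ∈ ℝ^d satisfy Q(t,z̄) ≠ Q(s,z̄). Then there exist open neighborhoods N of t and M of s in T and an open neighborhood W of z̄ in ℝ^d such that V(N,z) ≠ V(M,z) for every z ∈ W; that is, {z ∈ W : V(N,z) = V(M,z)} = ∅. -/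
open MeasureTheory

/-- If `Q t zb < Q s zb`, then for `z` near `zb` the value over any set containing `t` lies strictly
below the value over a suitable open neighborhood of `s`. -/
theorem exists_valueFn_lt {T : Type*} [TopologicalSpace T] {d : ℕ} {Q : T → (Fin d → ℝ) → ℝ}
    (hQ : Continuous (fun p : T × (Fin d → ℝ) => Q p.1 p.2))
    {t s : T} {zb : Fin d → ℝ} (hts : Q t zb < Q s zb) :
    ∃ M : Set T, ∃ W : Set (Fin d → ℝ), IsOpen M ∧ s ∈ M ∧ IsOpen W ∧ zb ∈ W ∧
      ∀ N : Set T, t ∈ N → ∀ z ∈ W, valueFn Q N z < valueFn Q M z := by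
  obtain ⟨c, htc, hcs⟩ := exists_between hts
  obtain ⟨M, W, hM, hW, hsM, hzW, hsub⟩ :=
    isOpen_prod_iff.1
      (isOpen_lt continuous_const hQ : IsOpen {p : T × (Fin d → ℝ) | c < Q p.1 p.2}) s zb hcs
  have hQt : Continuous (Q t) := hQ.comp (Continuous.prodMk_right t)
  refine ⟨M, W ∩ {z | Q t z < c}, hM, hsM, hW.inter (isOpen_lt hQt continuous_const),
    ⟨hzW, htc⟩, fun N htN z hz => ?_⟩
  calc valueFn Q N z ≤ (Q t z : EReal) := iInf₂_le t htN
    _ < (c : EReal) := EReal.coe_lt_coe_iff.2 hz.2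
    _ ≤ valueFn Q M z :=
      le_iInf₂ fun r hr => EReal.coe_le_coe_iff.2 (le_of_lt (hsub (Set.mk_mem_prod hr hz.1)))

/-- Lemma 4: if the objective takes different values at two points,
then the local infima near those points remain different for all nearby realizations. -/
theorem separation_of_values {T : Type*} [TopologicalSpace T] (d : ℕ)
    (Q : T → (Fin d → ℝ) → ℝ)
    (hQ : Continuous (fun p : T × (Fin d → ℝ) => Q p.1 p.2))
    (t s : T) (zb : Fin d → ℝ) (hts : Q t zb ≠ Q s zb) :
    ∃ N M : Set T, ∃ W : Set (Fin d → ℝ),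
      IsOpen N ∧ t ∈ N ∧ IsOpen M ∧ s ∈ M ∧ IsOpen W ∧ zb ∈ W ∧
      (∀ z ∈ W, valueFn Q N z ≠ valueFn Q M z) ∧
      {z ∈ W | valueFn Q N z = valueFn Q M z} = ∅ := by
  suffices h : ∃ N M : Set T, ∃ W : Set (Fin d → ℝ),
      IsOpen N ∧ t ∈ N ∧ IsOpen M ∧ s ∈ M ∧ IsOpen W ∧ zb ∈ W ∧
      ∀ z ∈ W, valueFn Q N z ≠ valueFn Q M z by
    obtain ⟨N, M, W, hN, htN, hM, hsM, hW, hzW, hne⟩ := h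
    exact ⟨N, M, W, hN, htN, hM, hsM, hW, hzW, hne,
      Set.eq_empty_iff_forall_notMem.2 fun z hz => hne z hz.1 hz.2⟩
  rcases hts.lt_or_gt with h | h
  · obtain ⟨M, W, hM, hsM, hW, hzW, hlt⟩ := exists_valueFn_lt hQ h
    exact ⟨Set.univ, M, W, isOpen_univ, Set.mem_univ _, hM, hsM, hW, hzW,
      fun z hz => (hlt _ (Set.mem_univ _) z hz).ne⟩
  · obtain ⟨N, W, hN, htN, hW, hzW, hlt⟩ := exists_valueFn_lt hQ h
    exact ⟨N, Set.univ, W, hN, htN, isOpen_univ, Set.mem_univ _, hW, hzW,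
      fun z hz => (hlt _ (Set.mem_univ _) z hz).ne'⟩
end

section
/- Let T be a locally compact Hausdorff topological space and let Q : T × ℝ^d → ℝ be jointly continuous, with z ↦ Q(t,z) differentiable for each t ∈ T and with (t,z) ↦ ∇_z Q(t,z) jointly continuous. Let P be a probability measure on ℝ^d absolutely continuous with respect to Lebesgue measure. Let t, s ∈ T and z̄ ∈ ℝ^d satisfy ∇_z Q(t,z̄) ≠ ∇_z Q(s,z̄). Then there exist open neighborhoods N of t and M of s in T and an open neighborhood W of z̄ in ℝ^d such that the set {z ∈ W : V(N,z) = V(M,z)} is P-null. -/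
open MeasureTheory

theorem measurable_valueFn {T : Type*} {d : ℕ} {Q : T → (Fin d → ℝ) → ℝ}
    (hQ : ∀ t, Continuous (Q t)) (K : Set T) : Measurable (valueFn Q K) := by
  refine UpperSemicontinuous.measurable ?_
  exact upperSemicontinuous_biInf fun t _ =>
    (continuous_coe_real_ereal.comp (hQ t)).upperSemicontinuous

/-- If the derivatives in direction `e` of the functions indexed by `N` exceed those of the
functions indexed by `M` by a gap, then the two value functions cannot agree at two distinct
points of a line in direction `e`. -/
theorem valueFn_ne_of_fderiv_gap {T : Type*} {d : ℕ} {Q : T → (Fin d → ℝ) → ℝ}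
    (hdiff : ∀ t, Differentiable ℝ (Q t)) {N M : Set T} {W : Set (Fin d → ℝ)}
    (hW : Convex ℝ W) {e : Fin d → ℝ} {a b c : ℝ} (hba : b < a) (hN : N.Nonempty)
    (hNa : ∀ t ∈ N, ∀ z ∈ W, a < fderiv ℝ (Q t) z e)
    (hMb : ∀ s ∈ M, ∀ z ∈ W, fderiv ℝ (Q s) z e < b)
    (hNc : ∀ t ∈ N, ∀ z ∈ W, c < Q t z) {z : Fin d → ℝ} {h : ℝ} (hh : 0 < h)
    (hz : z ∈ W) (hz' : z + h • e ∈ W) (heq : valueFn Q N z = valueFn Q M z) :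
    valueFn Q N (z + h • e) ≠ valueFn Q M (z + h • e) := by
  intro heq'
  have mvt (t : T) : ∃ w ∈ W, Q t (z + h • e) - Q t z = h * fderiv ℝ (Q t) w e := by
    obtain ⟨w, hw, hwe⟩ := domain_mvt (f := Q t)
      (fun x _ => (hdiff t x).hasFDerivAt.hasFDerivWithinAt) hW hz hz'
    exact ⟨w, hW.segment_subset hz hz' hw, by simpa using hwe⟩
  obtain ⟨t₀, ht₀⟩ := hN
  have htop : valueFn Q N z ≠ ⊤ :=
    ((iInf₂_le t₀ ht₀).trans_lt (EReal.coe_lt_top (Q t₀ z))).ne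
  have hbot : valueFn Q N z ≠ ⊥ := by
    have hle : (c : EReal) ≤ valueFn Q N z :=
      le_iInf₂ fun t ht => EReal.coe_le_coe_iff.2 (hNc t ht z hz).le
    exact ((EReal.bot_lt_coe c).trans_le hle).ne'
  obtain ⟨x, hx⟩ : ∃ x : ℝ, valueFn Q N z = x := ⟨_, (EReal.coe_toReal htop hbot).symm⟩
  have hlow : ((x + a * h : ℝ) : EReal) ≤ valueFn Q N (z + h • e) := by
    refine le_iInf₂ fun t ht => EReal.coe_le_coe_iff.2 ?_
    have hxt : x ≤ Q t z := EReal.coe_le_coe_iff.1 (hx ▸ iInf₂_le t ht)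
    obtain ⟨w, hw, hwe⟩ := mvt t
    nlinarith [hNa t ht w hw]
  have hlt : valueFn Q M z < ((x + (a - b) * h : ℝ) : EReal) := by
    rw [← heq, hx, EReal.coe_lt_coe_iff]
    nlinarith
  obtain ⟨s, hs, hsx⟩ := (by simpa only [valueFn, iInf_lt_iff, exists_prop] using hlt :
    ∃ s ∈ M, (Q s z : EReal) < _)
  have hup : x + a * h ≤ Q s (z + h • e) :=
    EReal.coe_le_coe_iff.1 ((hlow.trans_eq heq').trans (iInf₂_le s hs))
  have hsx' := EReal.coe_lt_coe_iff.1 hsx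
  obtain ⟨w, hw, hwe⟩ := mvt s
  nlinarith [hMb s hs w hw]

/-- A measurable set meeting every line in direction `e` at most once is null. -/
theorem volume_eq_zero_of_line_inter_subsingleton {d : ℕ} {A : Set (Fin d → ℝ)}
    (hA : MeasurableSet A) (e : Fin d → ℝ)
    (hline : ∀ z ∈ A, ∀ h : ℝ, 0 < h → z + h • e ∉ A) : volume A = 0 := by
  have hu := tendsto_one_div_add_atTop_nhds_zero_nat (𝕜 := ℝ)
  refine Measure.addHaar_eq_zero_of_disjoint_translates volume
    (fun n : ℕ => (1 / ((n : ℝ) + 1)) • e)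
    (Metric.isBounded_range_of_tendsto _ (hu.smul_const e)) ?_ hA
  refine (pairwise_disjoint_on _).2 fun m n hmn => ?_
  rw [Set.disjoint_left]
  rintro _ hm hn
  simp only [Set.singleton_add, Set.mem_image] at hm hn
  obtain ⟨y, hy, rfl⟩ := hm
  obtain ⟨w, hw, hwy⟩ := hn
  refine hline y hy (1 / ((m : ℝ) + 1) - 1 / ((n : ℝ) + 1))
    (sub_pos.2 (Nat.one_div_lt_one_div hmn)) ?_
  convert hw using 1
  rw [sub_smul, eq_sub_of_add_eq' hwy]
  abel

/-- Lemma 6: if the `z`-derivatives of the objective at two points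
differ, then the local value functions near those points coincide only on a `P`-null
set of realizations. -/
theorem distinct_z_derivatives_null_crossing {T : Type*} [TopologicalSpace T]
    [LocallyCompactSpace T] [T2Space T] (d : ℕ)
    (Q : T → (Fin d → ℝ) → ℝ)
    (hQ : Continuous (fun p : T × (Fin d → ℝ) => Q p.1 p.2))
    (hdiff : ∀ t : T, Differentiable ℝ (fun z => Q t z))
    (hgradcont : Continuous (fun p : T × (Fin d → ℝ) => fderiv ℝ (fun z => Q p.1 z) p.2))
    (P : Measure (Fin d → ℝ)) [IsProbabilityMeasure P] (hP : P ≪ volume)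
    (t s : T) (zb : Fin d → ℝ)
    (hne : fderiv ℝ (fun z => Q t z) zb ≠ fderiv ℝ (fun z => Q s z) zb) :
    ∃ N M : Set T, ∃ W : Set (Fin d → ℝ),
      IsOpen N ∧ t ∈ N ∧ IsOpen M ∧ s ∈ M ∧ IsOpen W ∧ zb ∈ W ∧
      ∃ A : Set (Fin d → ℝ),
        {z ∈ W | valueFn Q N z = valueFn Q M z} ⊆ A ∧ MeasurableSet A ∧ P A = 0 := by
  obtain ⟨e, he⟩ : ∃ e, fderiv ℝ (Q s) zb e < fderiv ℝ (Q t) zb e := by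
    by_contra! H
    refine hne (ContinuousLinearMap.ext fun e => le_antisymm (H e) ?_)
    simpa using H (-e)
  obtain ⟨b, hsb, hbt⟩ := exists_between he
  obtain ⟨a, hba, hat⟩ := exists_between hbt
  have hD : Continuous fun p : T × (Fin d → ℝ) => fderiv ℝ (Q p.1) p.2 e :=
    hgradcont.clm_apply continuous_const
  have hNW : ∀ᶠ p : T × (Fin d → ℝ) in nhds (t, zb),
      a < fderiv ℝ (Q p.1) p.2 e ∧ Q t zb - 1 < Q p.1 p.2 :=
    (hD.continuousAt.eventually (lt_mem_nhds hat)).and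
      (hQ.continuousAt.eventually (lt_mem_nhds (sub_one_lt (Q t zb))))
  have hMW : ∀ᶠ p : T × (Fin d → ℝ) in nhds (s, zb), fderiv ℝ (Q p.1) p.2 e < b :=
    hD.continuousAt.eventually (gt_mem_nhds hsb)
  obtain ⟨N, W₁, hNo, htN, hW₁o, hzW₁, hN⟩ := mem_nhds_prod_iff'.1 hNW
  obtain ⟨M, W₂, hMo, hsM, hW₂o, hzW₂, hM⟩ := mem_nhds_prod_iff'.1 hMW
  obtain ⟨r, hr, hball⟩ := Metric.isOpen_iff.1 (hW₁o.inter hW₂o) zb ⟨hzW₁, hzW₂⟩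
  have hcont (t : T) : Continuous (Q t) := (hdiff t).continuous
  have hmeas : MeasurableSet {z ∈ Metric.ball zb r | valueFn Q N z = valueFn Q M z} :=
    measurableSet_ball.inter
      (measurableSet_eq_fun (measurable_valueFn hcont N) (measurable_valueFn hcont M))
  refine ⟨N, M, Metric.ball zb r, hNo, htN, hMo, hsM, Metric.isOpen_ball,
    Metric.mem_ball_self hr, _, subset_rfl, hmeas, hP ?_⟩
  refine volume_eq_zero_of_line_inter_subsingleton hmeas e
    fun z hz h hh hz' => ?_
  exact valueFn_ne_of_fderiv_gap hdiff (convex_ball zb r) hba ⟨t, htN⟩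
    (fun t ht z hz => (hN (Set.mk_mem_prod ht (hball hz).1)).1)
    (fun s hs z hz => hM (Set.mk_mem_prod hs (hball hz).2))
    (fun t ht z hz => (hN (Set.mk_mem_prod ht (hball hz).1)).2) hh hz.1 hz'.1 hz.2 hz'.2
end

section
/- Let N and M be nonempty sets, let W ⊆ ℝ^d be open and convex, let λ ∈ ℝ^d, ε > 0, and let Q : (N ∪ M) × ℝ^d → ℝ be such that for every t ∈ N ∪ M the map z ↦ Q(t,z) is differentiable on W, and such that for all t̃ ∈ N, s̃ ∈ M, and z ∈ W the directional derivative satisfies ∇_z(Q(t̃,z) − Q(s̃,z))·λ < −ε. Assume V(N,z) and V(M,z) are finite for all z ∈ W. Then for any z', z'' ∈ W with z' − z'' a nonzero scalar multiple of λ, it cannot be that both V(N,z') = V(M,z') and V(N,z'') = V(M,z''); equivalently, on any line in direction λ there is at most one point z ∈ W with V(N,z) = V(M,z). -/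
open MeasureTheory

/-- A function on a convex set whose directional derivative along `v` is less than `C`
grows by less than `a * C` along the step `a • v`. -/
theorem Convex.sub_lt_mul_of_fderiv_apply_lt {E : Type*} [NormedAddCommGroup E]
    [NormedSpace ℝ E] {W : Set E} (hW : Convex ℝ W) {f : E → ℝ} {v : E} {C : ℝ}
    (hf : ∀ z ∈ W, DifferentiableAt ℝ f z) (hC : ∀ z ∈ W, fderiv ℝ f z v < C)
    {x : E} {a : ℝ} (ha : 0 < a) (hx : x ∈ W) (hxa : x + a • v ∈ W) :
    f (x + a • v) - f x < a * C := by
  have mem : ∀ τ ∈ Set.Icc (0 : ℝ) 1, x + τ • (a • v) ∈ W := fun τ hτ =>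
    hW.add_smul_mem hx hxa hτ
  have key : ∀ τ ∈ Set.Icc (0 : ℝ) 1,
      HasDerivAt (fun τ : ℝ => f (x + τ • (a • v))) (a * fderiv ℝ f (x + τ • (a • v)) v) τ := by
    intro τ hτ
    have h₁ : HasDerivAt (fun τ : ℝ => x + τ • (a • v)) (a • v) τ := by
      simpa using ((hasDerivAt_id τ).smul_const (a • v)).const_add x
    have h₂ := (hf _ (mem τ hτ)).hasFDerivAt.comp_hasDerivAt τ h₁
    rw [map_smul, smul_eq_mul] at h₂
    exact h₂
  obtain ⟨c, hc, hcs⟩ := exists_hasDerivAt_eq_slope (fun τ : ℝ => f (x + τ • (a • v))) _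
    zero_lt_one (fun τ hτ => (key τ hτ).continuousAt.continuousWithinAt)
    (fun τ hτ => key τ (Set.Ioo_subset_Icc_self hτ))
  have hlt := hC _ (mem c (Set.Ioo_subset_Icc_self hc))
  simp only [one_smul, zero_smul, add_zero, sub_zero, div_one] at hcs
  rw [← hcs]
  exact mul_lt_mul_of_pos_left hlt ha

/-- If every increment of the family `p → q` over `N` lies below every increment over `M` by at
least `δ > 0`, then the infima over `N` and `M` cannot agree both for `p` and for `q`. -/
theorem not_sInf_image_eq_and_sInf_image_eq {α : Type*} {N M : Set α} (hN : N.Nonempty)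
    (hM : M.Nonempty) {p q : α → ℝ} {δ : ℝ} (hδ : 0 < δ)
    (h : ∀ t ∈ N, ∀ s ∈ M, (q t - q s) - (p t - p s) ≤ -δ)
    (hbN : BddBelow (q '' N)) (hbM : BddBelow (p '' M)) :
    ¬ (sInf (q '' N) = sInf (q '' M) ∧ sInf (p '' N) = sInf (p '' M)) := by
  rintro ⟨hq, hp⟩
  obtain ⟨_, ⟨t, ht, rfl⟩, ht'⟩ := Real.lt_sInf_add_pos (hN.image p) (half_pos hδ)
  obtain ⟨_, ⟨s, hs, rfl⟩, hs'⟩ := Real.lt_sInf_add_pos (hM.image q) (half_pos hδ)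
  have h₁ := csInf_le hbN (Set.mem_image_of_mem q ht)
  have h₂ := csInf_le hbM (Set.mem_image_of_mem p hs)
  linarith [h t ht s hs]

/-- crossing step in the proof of Lemma 6: under a uniform strict
separation of directional `z`-derivatives, the two local value functions
`V(N,·)` and `V(M,·)` cross at most once along each line in direction `λ` within the
open convex set `W`. -/
theorem value_functions_cross_at_most_once {α : Type*} (d : ℕ)
    (N M : Set α) (hN : N.Nonempty) (hM : M.Nonempty)
    (W : Set (Fin d → ℝ)) (hWopen : IsOpen W) (hWconv : Convex ℝ W)
    (lam : Fin d → ℝ) (ε : ℝ) (hε : 0 < ε)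
    (Q : α → (Fin d → ℝ) → ℝ)
    (hdiff : ∀ t ∈ N ∪ M, ∀ z ∈ W, DifferentiableAt ℝ (fun z' => Q t z') z)
    (hsep : ∀ t ∈ N, ∀ s ∈ M, ∀ z ∈ W,
      fderiv ℝ (fun z' => Q t z' - Q s z') z lam < -ε)
    (hbddN : ∀ z ∈ W, BddBelow ((fun t => Q t z) '' N))
    (hbddM : ∀ z ∈ W, BddBelow ((fun t => Q t z) '' M)) :
    ∀ z' ∈ W, ∀ z'' ∈ W, ∀ a : ℝ, a ≠ 0 → z' - z'' = a • lam →
      ¬ (sInf ((fun t => Q t z') '' N) = sInf ((fun t => Q t z') '' M) ∧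
         sInf ((fun t => Q t z'') '' N) = sInf ((fun t => Q t z'') '' M)) := by
  have pos : ∀ x ∈ W, ∀ y ∈ W, ∀ a : ℝ, 0 < a → y - x = a • lam →
      ¬ (sInf ((fun t => Q t y) '' N) = sInf ((fun t => Q t y) '' M) ∧
         sInf ((fun t => Q t x) '' N) = sInf ((fun t => Q t x) '' M)) := by
    intro x hx y hy a ha hxy
    obtain rfl : y = x + a • lam := by rw [← hxy, add_sub_cancel]
    refine not_sInf_image_eq_and_sInf_image_eq hN hM (mul_pos ha hε) ?_ (hbddN _ hy) (hbddM _ hx)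
    intro t ht s hs
    have h := hWconv.sub_lt_mul_of_fderiv_apply_lt
      (fun z hz => (hdiff t (Or.inl ht) z hz).fun_sub (hdiff s (Or.inr hs) z hz))
      (hsep t ht s hs) ha hx hy
    linarith
  intro z' hz' z'' hz'' a ha h
  rcases ha.lt_or_gt with ha | ha
  · rw [and_comm]
    exact pos z' hz' z'' hz'' (-a) (neg_pos.2 ha) (by rw [neg_smul, ← h, neg_sub])
  · exact pos z'' hz'' z' hz' a ha h
end

section
/- Let n and J be positive integers with J² ≤ n, and let P be a probability measure on ℝ^n absolutely continuous with respect to Lebesgue measure. Then for P-almost every z ∈ ℝ^n, the function (τ,μ) ↦ Q_J(τ,μ,z) has at most one global minimizer over the ordered mixture parameter space T_J. -/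
open MeasureTheory

/-- The standard normal density `φ(x) = (2π)^{-1/2} exp(-x²/2)`. -/
noncomputable def stdNormalPdf (x : ℝ) : ℝ :=
  (Real.sqrt (2 * Real.pi))⁻¹ * Real.exp (-(x ^ 2) / 2)

/-- The ordered mixture parameter space
`T_K = {(τ,μ) : τ_j > 0, ∑ τ_j = 1, μ strictly increasing}`. -/
def orderedMixtureSpace (K : ℕ) : Set ((Fin K → ℝ) × (Fin K → ℝ)) :=
  {p | (∀ j, 0 < p.1 j) ∧ (∑ j, p.1 j) = 1 ∧ StrictMono p.2}

/-- The negative log-likelihood of a `K`-component normal location mixture. -/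
noncomputable def mixtureNegLogLik (n K : ℕ) (p : (Fin K → ℝ) × (Fin K → ℝ))
    (z : Fin n → ℝ) : ℝ :=
  -∑ i, Real.log (∑ j, p.1 j * stdNormalPdf (z i - p.2 j))

/-- A consequence of Rademacher's theorem: a finite convex function on a
finite-dimensional space is differentiable almost everywhere. -/
theorem ConvexOn.ae_differentiableAt {E : Type*} [NormedAddCommGroup E] [NormedSpace ℝ E]
    [FiniteDimensional ℝ E] [MeasurableSpace E] [BorelSpace E] (ν : Measure E)
    [ν.IsAddHaarMeasure] {f : E → ℝ} (hf : ConvexOn ℝ Set.univ f) :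
    ∀ᵐ x ∂ν, DifferentiableAt ℝ f x := by
  have : ProperSpace E := FiniteDimensional.proper ℝ E
  refine measure_null_of_locally_null _ fun x _ => ?_
  obtain ⟨K, t, ht, hK⟩ := hf.locallyLipschitz x
  obtain ⟨u, hut, hu, hxu⟩ := mem_nhds_iff.1 ht
  have h := (hK.mono hut).ae_differentiableWithinAt_of_mem (μ := ν)
  refine ⟨_, inter_mem_nhdsWithin _ (hu.mem_nhds hxu), measure_mono_null ?_ (ae_iff.1 h)⟩
  rintro y ⟨hy, hyu⟩ hdiff
  exact hy ((hdiff hyu).differentiableAt (hu.mem_nhds hyu))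

/-- A pointwise bounded supremum of convex functions is convex. -/
theorem convexOn_ciSup {E ι : Type*} [AddCommGroup E] [Module ℝ E] [Nonempty ι] {s : Set E}
    {f : ι → E → ℝ} (hs : Convex ℝ s) (hf : ∀ i, ConvexOn ℝ s (f i))
    (hb : ∀ x, BddAbove (Set.range fun i => f i x)) :
    ConvexOn ℝ s (fun x => ⨆ i, f i x) := by
  refine ⟨hs, fun x hx y hy a b ha hb' hab => ciSup_le fun i => ?_⟩
  refine ((hf i).2 hx hy ha hb' hab).trans ?_
  simp only [smul_eq_mul]
  gcongr
  · exact le_ciSup (hb x) i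
  · exact le_ciSup (hb y) i

/-- Almost every vector has pairwise distinct coordinates. -/
theorem ae_injective_pi (ι : Type*) [Fintype ι] :
    ∀ᵐ z : ι → ℝ, Function.Injective z := by
  have h : ∀ i j : ι, ∀ᵐ z : ι → ℝ, z i = z j → i = j := by
    intro i j
    by_cases hij : i = j
    · simp [hij]
    let L : (ι → ℝ) →ₗ[ℝ] ℝ :=
      LinearMap.proj (R := ℝ) (φ := fun _ => ℝ) i - LinearMap.proj (R := ℝ) (φ := fun _ => ℝ) j
    have hL : LinearMap.ker L ≠ ⊤ := by
      classical
      intro h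
      have := LinearMap.congr_fun (LinearMap.ker_eq_top.1 h) (Pi.single i 1)
      simp [L, Ne.symm hij] at this
    have := Measure.addHaar_submodule volume _ hL
    rw [ae_iff]
    refine measure_mono_null (fun z hz => ?_) this
    simp only [Set.mem_ofPred_eq, Classical.not_imp] at hz
    simp [L, hz.1]
  have := ae_all_iff.2 fun i => ae_all_iff.2 (h i)
  filter_upwards [this] with z hz i j hij using hz i j hij

/-- A real exponential sum with at most `n` frequencies vanishing at `n` increasing points has
zero coefficients. -/
theorem expSum_coeff_eq_zero_of_strictMono (S : Finset ℝ) :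
    ∀ (a : ℝ → ℝ) (n : ℕ) (x : Fin n → ℝ), StrictMono x → S.card ≤ n →
      (∀ i, ∑ c ∈ S, a c * Real.exp (c * x i) = 0) → ∀ c ∈ S, a c = 0 := by
  classical
  induction S using Finset.induction_on with
  | empty => simp
  | insert d S hd ih =>
    intro a n x hx hn h
    rw [Finset.card_insert_of_notMem hd] at hn
    obtain ⟨n, rfl⟩ : ∃ m, n = m + 1 := ⟨n - 1, by omega⟩
    have hder : ∀ t, HasDerivAt (fun t => a d + ∑ c ∈ S, a c * Real.exp ((c - d) * t))
        (∑ c ∈ S, a c * (Real.exp ((c - d) * t) * (c - d))) t := by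
      intro t
      refine HasDerivAt.const_add _ (HasDerivAt.fun_sum fun c _ => ?_)
      simpa using (((hasDerivAt_id t).const_mul (c - d)).exp).const_mul (a c)
    have hzero : ∀ i, a d + ∑ c ∈ S, a c * Real.exp ((c - d) * x i) = 0 := by
      intro i
      have := h i
      rw [Finset.sum_insert hd] at this
      have h2 : Real.exp (d * x i) * (a d + ∑ c ∈ S, a c * Real.exp ((c - d) * x i)) = 0 := by
        rw [← this, mul_add, Finset.mul_sum]
        congr 1
        · ring
        · refine Finset.sum_congr rfl fun c _ => ?_
          rw [mul_left_comm, ← Real.exp_add]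
          ring_nf
      exact (mul_eq_zero.1 h2).resolve_left (Real.exp_ne_zero _)
    have hrolle : ∀ i : Fin n, ∃ y ∈ Set.Ioo (x i.castSucc) (x i.succ),
        ∑ c ∈ S, a c * (Real.exp ((c - d) * y) * (c - d)) = 0 := fun i =>
      exists_hasDerivAt_eq_zero (hx i.castSucc_lt_succ)
        (fun t _ => (hder t).continuousAt.continuousWithinAt)
        ((hzero _).trans (hzero _).symm) (fun t _ => hder t)
    choose y hy hy0 using hrolle
    have hymono : StrictMono y := fun i j hij =>
      ((hy i).2.trans_le (hx.monotone (Fin.succ_le_castSucc_iff.2 hij))).trans (hy j).1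
    have hS := ih (fun c => a c * (c - d)) n y hymono (by omega) fun i => by
      rw [← mul_zero (Real.exp (d * y i)), ← hy0 i, Finset.mul_sum]
      refine Finset.sum_congr rfl fun c _ => ?_
      have : c * y i = d * y i + (c - d) * y i := by ring
      rw [this, Real.exp_add]
      ring
    have hS' : ∀ c ∈ S, a c = 0 := fun c hc =>
      (mul_eq_zero.1 (hS c hc)).resolve_right
        (sub_ne_zero.2 fun h => hd (h ▸ hc))
    intro c hc
    rcases Finset.mem_insert.1 hc with rfl | hc
    · have := hzero 0
      rwa [Finset.sum_eq_zero fun c hc => by rw [hS' c hc, zero_mul], add_zero] at this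
    · exact hS' c hc

/-- A real exponential sum vanishing on a finite set at least as large as its set of frequencies
has zero coefficients. -/
theorem expSum_coeff_eq_zero {S Z : Finset ℝ} (hSZ : S.card ≤ Z.card) {a : ℝ → ℝ}
    (h : ∀ x ∈ Z, ∑ c ∈ S, a c * Real.exp (c * x) = 0) : ∀ c ∈ S, a c = 0 :=
  expSum_coeff_eq_zero_of_strictMono S a _ (Z.orderEmbOfFin rfl) (Z.orderEmbOfFin rfl).strictMono
    hSZ fun i => h _ (Z.orderEmbOfFin_mem rfl i)

/-- The exponential sum `∑ a_k exp(m_k x)`. -/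
noncomputable def expSum {ι : Type*} [Fintype ι] (a m : ι → ℝ) (x : ℝ) : ℝ :=
  ∑ k, a k * Real.exp (m k * x)

section expSum

variable {ι κ : Type*} [Fintype ι] [Fintype κ]

theorem expSum_pos [Nonempty ι] {a : ι → ℝ} (ha : ∀ k, 0 < a k) (m : ι → ℝ) (x : ℝ) :
    0 < expSum a m x :=
  Finset.sum_pos (fun k _ => mul_pos (ha k) (Real.exp_pos _)) Finset.univ_nonempty

theorem hasDerivAt_expSum (a m : ι → ℝ) (x : ℝ) :
    HasDerivAt (expSum a m) (expSum (fun k => a k * m k) m x) x := by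
  refine HasDerivAt.fun_sum fun k _ => ?_
  have := (((hasDerivAt_id x).const_mul (m k)).exp).const_mul (a k)
  simp only [id, mul_one] at this
  rwa [mul_comm (Real.exp _), ← mul_assoc] at this

/-- Collecting equal frequencies in an exponential sum. -/
theorem expSum_eq_sum_fiber [DecidableEq ℝ] (a m : ι → ℝ) {S : Finset ℝ} (hS : ∀ k, m k ∈ S)
    (x : ℝ) :
    expSum a m x = ∑ c ∈ S, (∑ k with m k = c, a k) * Real.exp (c * x) := by
  rw [expSum, ← Finset.sum_fiberwise_of_maps_to (t := S) (g := m) (fun k _ => hS k)]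
  refine Finset.sum_congr rfl fun c _ => ?_
  rw [Finset.sum_mul]
  refine Finset.sum_congr rfl fun k hk => ?_
  rw [(Finset.mem_filter.1 hk).2]

/-- An exponential sum with at least as many zeros as terms vanishes identically. -/
theorem expSum_eq_zero_of_card_le {a m : ι → ℝ} {Z : Finset ℝ} (hZ : Fintype.card ι ≤ Z.card)
    (h : ∀ x ∈ Z, expSum a m x = 0) (x : ℝ) : expSum a m x = 0 := by
  classical
  have hmem : ∀ k, m k ∈ Finset.univ.image m := fun k =>
    Finset.mem_image_of_mem _ (Finset.mem_univ k)
  have key := expSum_coeff_eq_zero (S := Finset.univ.image m) (Z := Z)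
    (a := fun c => ∑ k with m k = c, a k) (Finset.card_image_le.trans hZ) fun y hy => by
      rw [← expSum_eq_sum_fiber a m hmem, h y hy]
  rw [expSum_eq_sum_fiber a m hmem]
  exact Finset.sum_eq_zero fun c hc => by rw [key c hc, zero_mul]

/-- The Wronskian of two exponential sums is an exponential sum over pairs of indices. -/
theorem expSum_wronskian (a m : ι → ℝ) (b v : κ → ℝ) (x : ℝ) :
    expSum (fun k => a k * m k) m x * expSum b v x -
        expSum a m x * expSum (fun k => b k * v k) v x =
      expSum (fun k : ι × κ => a k.1 * b k.2 * (m k.1 - v k.2))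
        (fun k => m k.1 + v k.2) x := by
  simp only [expSum, Finset.sum_mul_sum, ← Finset.sum_sub_distrib, Fintype.sum_prod_type]
  refine Finset.sum_congr rfl fun j _ => Finset.sum_congr rfl fun k _ => ?_
  rw [add_mul, Real.exp_add]
  ring

/-- Proportional exponential sums have the same coefficient at each frequency, up to the factor. -/
theorem sum_fiber_eq_of_expSum_eq [DecidableEq ℝ] {a m : ι → ℝ} {b v : κ → ℝ} {C : ℝ}
    (h : ∀ x, expSum a m x = C * expSum b v x) (c : ℝ) :
    ∑ k with m k = c, a k = C * ∑ k with v k = c, b k := by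
  let S : Finset ℝ := insert c (Finset.univ.image m ∪ Finset.univ.image v)
  obtain ⟨Z, hZ⟩ := Infinite.exists_subset_card_eq ℝ S.card
  have key := expSum_coeff_eq_zero (S := S) (Z := Z) hZ.ge
    (a := fun c => (∑ k with m k = c, a k) - C * ∑ k with v k = c, b k) fun x _ => by
      simp only [sub_mul, Finset.sum_sub_distrib, mul_assoc, ← Finset.mul_sum]
      rw [← expSum_eq_sum_fiber a m (by simp [S]), ← expSum_eq_sum_fiber b v (by simp [S]), h x,
        sub_self]
  exact sub_eq_zero.1 (key c (Finset.mem_insert_self _ _))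

/-- The logarithm of an exponential sum with positive coefficients is convex. -/
theorem convexOn_log_expSum [Nonempty ι] {a : ι → ℝ} (ha : ∀ k, 0 < a k) (m : ι → ℝ) :
    ConvexOn ℝ Set.univ fun x => Real.log (expSum a m x) := by
  refine ⟨convex_univ, fun x _ y _ s t hs ht hst => ?_⟩
  simp only [smul_eq_mul]
  rw [Real.log_le_iff_le_exp (expSum_pos ha m _)]
  set A := Real.log (expSum a m x) with hA
  set B := Real.log (expSum a m y) with hB
  have hk : ∀ k, a k * Real.exp (m k * (s * x + t * y)) ≤ Real.exp (s * A + t * B) *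
      (s * (Real.exp (-A) * (a k * Real.exp (m k * x))) +
        t * (Real.exp (-B) * (a k * Real.exp (m k * y)))) := by
    intro k
    have h := convexOn_exp.2 (Set.mem_univ (m k * x - A)) (Set.mem_univ (m k * y - B)) hs ht hst
    simp only [smul_eq_mul] at h
    have e : m k * (s * x + t * y) =
        (s * A + t * B) + (s * (m k * x - A) + t * (m k * y - B)) := by ring
    have e1 : Real.exp (m k * x - A) = Real.exp (-A) * Real.exp (m k * x) := by
      rw [← Real.exp_add]; ring_nf
    have e2 : Real.exp (m k * y - B) = Real.exp (-B) * Real.exp (m k * y) := by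
      rw [← Real.exp_add]; ring_nf
    rw [e, Real.exp_add]
    calc _ = Real.exp (s * A + t * B) *
          (a k * Real.exp (s * (m k * x - A) + t * (m k * y - B))) := by ring
      _ ≤ Real.exp (s * A + t * B) *
          (a k * (s * Real.exp (m k * x - A) + t * Real.exp (m k * y - B))) := by
        have := (ha k).le
        gcongr
      _ = _ := by rw [e1, e2]; ring
  refine (Finset.sum_le_sum fun k _ => hk k).trans_eq ?_
  have hA' : Real.exp (-A) * expSum a m x = 1 := by
    rw [Real.exp_neg, hA, Real.exp_log (expSum_pos ha m x),
      inv_mul_cancel₀ (expSum_pos ha m x).ne']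
  have hB' : Real.exp (-B) * expSum a m y = 1 := by
    rw [Real.exp_neg, hB, Real.exp_log (expSum_pos ha m y),
      inv_mul_cancel₀ (expSum_pos ha m y).ne']
  rw [← Finset.mul_sum, Finset.sum_add_distrib]
  simp only [← Finset.mul_sum]
  change _ * (s * (_ * expSum a m x) + t * (_ * expSum a m y)) = _
  rw [hA', hB', mul_one, mul_one, hst, mul_one]

/-- Positive exponential sums whose logarithmic derivatives agree at sufficiently many points
are proportional. -/
theorem exists_expSum_eq_mul [Nonempty ι] [Nonempty κ] {a m : ι → ℝ} {b v : κ → ℝ}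
    (ha : ∀ k, 0 < a k) (hb : ∀ k, 0 < b k) {Z : Finset ℝ}
    (hZ : Fintype.card ι * Fintype.card κ ≤ Z.card)
    (h : ∀ x ∈ Z, expSum (fun k => a k * m k) m x / expSum a m x =
      expSum (fun k => b k * v k) v x / expSum b v x) :
    ∃ C > 0, ∀ x, expSum a m x = C * expSum b v x := by
  have hw : ∀ x, expSum (fun k => a k * m k) m x * expSum b v x -
      expSum a m x * expSum (fun k => b k * v k) v x = 0 := by
    intro x
    rw [expSum_wronskian]
    refine expSum_eq_zero_of_card_le (by rwa [Fintype.card_prod]) (fun y hy => ?_) x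
    rw [← expSum_wronskian]
    have := h y hy
    rw [div_eq_div_iff (expSum_pos ha m y).ne' (expSum_pos hb v y).ne'] at this
    rw [this]
    ring
  have hd : ∀ x, HasDerivAt (fun x => expSum a m x / expSum b v x) 0 x := by
    intro x
    have := (hasDerivAt_expSum a m x).fun_div (hasDerivAt_expSum b v x) (expSum_pos hb v x).ne'
    rwa [hw, zero_div] at this
  refine ⟨expSum a m 0 / expSum b v 0, div_pos (expSum_pos ha m 0) (expSum_pos hb v 0),
    fun x => ?_⟩
  rw [← div_eq_iff (expSum_pos hb v x).ne']
  exact is_const_of_deriv_eq_zero (fun y => (hd y).differentiableAt) (fun y => (hd y).deriv) x 0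

end expSum

/-- The coefficients `τ_j exp(-μ_j²/2)` of a normal mixture density relative to the standard
normal density. -/
noncomputable def tiltedWeight {K : ℕ} (p : (Fin K → ℝ) × (Fin K → ℝ)) (j : Fin K) : ℝ :=
  p.1 j * Real.exp (-(p.2 j ^ 2) / 2)

/-- The log-likelihood ratio of a normal location mixture against the standard normal. -/
noncomputable def mixtureLogLikRatio (n K : ℕ) (p : (Fin K → ℝ) × (Fin K → ℝ))
    (z : Fin n → ℝ) : ℝ :=
  ∑ i, Real.log (expSum (tiltedWeight p) p.2 (z i))

section mixture

variable {n K : ℕ} {p q : (Fin K → ℝ) × (Fin K → ℝ)}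

theorem stdNormalPdf_pos (x : ℝ) : 0 < stdNormalPdf x := by
  unfold stdNormalPdf
  positivity

theorem tiltedWeight_pos (hp : p ∈ orderedMixtureSpace K) (j : Fin K) : 0 < tiltedWeight p j :=
  mul_pos (hp.1 j) (Real.exp_pos _)

theorem mixture_density_eq (p : (Fin K → ℝ) × (Fin K → ℝ)) (x : ℝ) :
    ∑ j, p.1 j * stdNormalPdf (x - p.2 j) =
      stdNormalPdf x * expSum (tiltedWeight p) p.2 x := by
  rw [expSum, Finset.mul_sum]
  refine Finset.sum_congr rfl fun j _ => ?_
  have : -((x - p.2 j) ^ 2) / 2 = -(x ^ 2) / 2 + -(p.2 j ^ 2) / 2 + p.2 j * x := by ring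
  rw [stdNormalPdf, stdNormalPdf, tiltedWeight, this, Real.exp_add, Real.exp_add]
  ring

theorem mixtureNegLogLik_eq [NeZero K] (hp : p ∈ orderedMixtureSpace K) (z : Fin n → ℝ) :
    mixtureNegLogLik n K p z =
      -(∑ i, Real.log (stdNormalPdf (z i))) - mixtureLogLikRatio n K p z := by
  rw [mixtureNegLogLik, mixtureLogLikRatio, ← neg_add', ← Finset.sum_add_distrib]
  congr 1
  refine Finset.sum_congr rfl fun i _ => ?_
  rw [mixture_density_eq, Real.log_mul (stdNormalPdf_pos _).ne'
    (expSum_pos (tiltedWeight_pos hp) _ _).ne']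

theorem mixtureLogLikRatio_le [NeZero K] (hp : p ∈ orderedMixtureSpace K) (z : Fin n → ℝ) :
    mixtureLogLikRatio n K p z ≤ ∑ i, z i ^ 2 / 2 := by
  refine Finset.sum_le_sum fun i _ => ?_
  rw [Real.log_le_iff_le_exp (expSum_pos (tiltedWeight_pos hp) _ _), ← one_mul (Real.exp _),
    ← hp.2.1, Finset.sum_mul]
  refine Finset.sum_le_sum fun j _ => ?_
  rw [tiltedWeight, mul_assoc, ← Real.exp_add]
  refine mul_le_mul_of_nonneg_left (Real.exp_le_exp.2 ?_) (hp.1 j).le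
  nlinarith [sq_nonneg (z i - p.2 j)]

theorem convexOn_mixtureLogLikRatio [NeZero K] (hp : p ∈ orderedMixtureSpace K) :
    ConvexOn ℝ Set.univ (mixtureLogLikRatio n K p) := by
  refine ⟨convex_univ, fun x _ y _ s t hs ht hst => ?_⟩
  simp only [mixtureLogLikRatio, smul_eq_mul, Finset.mul_sum, ← Finset.sum_add_distrib]
  exact Finset.sum_le_sum fun i _ => (convexOn_log_expSum (tiltedWeight_pos hp) p.2).2
    (Set.mem_univ (x i)) (Set.mem_univ (y i)) hs ht hst

theorem hasFDerivAt_mixtureLogLikRatio [NeZero K] (hp : p ∈ orderedMixtureSpace K)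
    (z : Fin n → ℝ) :
    HasFDerivAt (mixtureLogLikRatio n K p)
      (∑ i, (expSum (fun j => tiltedWeight p j * p.2 j) p.2 (z i) /
        expSum (tiltedWeight p) p.2 (z i)) •
          (ContinuousLinearMap.proj i : (Fin n → ℝ) →L[ℝ] ℝ)) z := by
  refine HasFDerivAt.fun_sum fun i _ => ?_
  have hlog := (hasDerivAt_expSum (tiltedWeight p) p.2 (z i)).log
    (expSum_pos (tiltedWeight_pos hp) _ _).ne'
  have hproj : HasFDerivAt (fun w : Fin n → ℝ => w i)
      (ContinuousLinearMap.proj i : (Fin n → ℝ) →L[ℝ] ℝ) z := hasFDerivAt_apply i z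
  exact HasDerivAt.comp_hasFDerivAt (f := fun w : Fin n → ℝ => w i) z hlog hproj

/-- Identifiability: ordered mixtures with proportional relative densities coincide. -/
theorem eq_of_expSum_tiltedWeight_eq (hp : p ∈ orderedMixtureSpace K)
    (hq : q ∈ orderedMixtureSpace K) {C : ℝ} (hC : 0 < C)
    (h : ∀ x, expSum (tiltedWeight p) p.2 x = C * expSum (tiltedWeight q) q.2 x) : p = q := by
  classical
  have hcoef := sum_fiber_eq_of_expSum_eq h
  have hfib : ∀ {r : (Fin K → ℝ) × (Fin K → ℝ)}, r ∈ orderedMixtureSpace K → ∀ c,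
      c ∈ Set.range r.2 ↔ 0 < ∑ k with r.2 k = c, tiltedWeight r k := by
    intro r hr c
    constructor
    · rintro ⟨k, rfl⟩
      exact Finset.sum_pos (fun j _ => tiltedWeight_pos hr j) ⟨k, by simp⟩
    · intro hpos
      obtain ⟨k, hk, -⟩ := Finset.exists_ne_zero_of_sum_ne_zero hpos.ne'
      exact ⟨k, (Finset.mem_filter.1 hk).2⟩
  have hμ : p.2 = q.2 := by
    refine (hp.2.2.range_inj hq.2.2).1 (Set.ext fun c => ?_)
    rw [hfib hp, hfib hq, hcoef, mul_pos_iff_of_pos_left hC]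
  have hτ : ∀ k, p.1 k = C * q.1 k := by
    intro k
    have := hcoef (q.2 k)
    simp only [hμ, hq.2.2.injective.eq_iff, Finset.filter_eq', Finset.mem_univ, if_true,
      Finset.sum_singleton, tiltedWeight] at this
    rw [← mul_assoc] at this
    exact mul_right_cancel₀ (Real.exp_ne_zero _) this
  have hC1 : C = 1 := by
    have := hp.2.1
    simp only [hτ, ← Finset.mul_sum, hq.2.1, mul_one] at this
    exact this
  exact Prod.ext (funext fun k => by rw [hτ, hC1, one_mul]) hμ

end mixture

/-- Theorem 1: if `J² ≤ n`, then for `P`-almost every `z` the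
negative mixture log-likelihood has at most one global minimizer over the ordered
mixture parameter space `T_J`. -/
theorem mixture_mle_unique (n J : ℕ) (hn : 0 < n) (hJ : 0 < J) (hJn : J ^ 2 ≤ n)
    (P : Measure (Fin n → ℝ)) [IsProbabilityMeasure P] (hP : P ≪ volume) :
    ∀ᵐ z ∂P, ∀ p ∈ orderedMixtureSpace J, ∀ q ∈ orderedMixtureSpace J,
      (∀ r ∈ orderedMixtureSpace J, mixtureNegLogLik n J p z ≤ mixtureNegLogLik n J r z) →
      (∀ r ∈ orderedMixtureSpace J, mixtureNegLogLik n J q z ≤ mixtureNegLogLik n J r z) →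
      p = q := by
  have : NeZero J := ⟨hJ.ne'⟩
  rcases (orderedMixtureSpace J).eq_empty_or_nonempty with hempty | hne
  · simp [hempty]
  have : Nonempty (orderedMixtureSpace J) := hne.to_subtype
  have hbdd : ∀ z : Fin n → ℝ, BddAbove (Set.range fun p : orderedMixtureSpace J =>
      mixtureLogLikRatio n J p z) := fun z =>
    ⟨∑ i, z i ^ 2 / 2, Set.forall_mem_range.2 fun p => mixtureLogLikRatio_le p.2 z⟩
  have hdiff := (convexOn_ciSup convex_univ
    (fun p : orderedMixtureSpace J => convexOn_mixtureLogLikRatio (n := n) p.2)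
    hbdd).ae_differentiableAt volume
  filter_upwards [hP.ae_le hdiff, hP.ae_le (ae_injective_pi (Fin n))] with z hz hinj p hp q hq
    hpmin hqmin
  have hfderiv : ∀ {r}, ∀ hr : r ∈ orderedMixtureSpace J,
      (∀ s ∈ orderedMixtureSpace J, mixtureNegLogLik n J r z ≤ mixtureNegLogLik n J s z) →
      fderiv ℝ (fun z => ⨆ s : orderedMixtureSpace J, mixtureLogLikRatio n J s z) z =
        ∑ i, (expSum (fun j => tiltedWeight r j * r.2 j) r.2 (z i) /
          expSum (tiltedWeight r) r.2 (z i)) •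
            (ContinuousLinearMap.proj i : (Fin n → ℝ) →L[ℝ] ℝ) := by
    intro r hr hmin
    refine sub_eq_zero.1 (IsLocalMin.hasFDerivAt_eq_zero (Filter.Eventually.of_forall fun w => ?_)
      (hz.hasFDerivAt.fun_sub (hasFDerivAt_mixtureLogLikRatio hr z)))
    have hle : ⨆ s : orderedMixtureSpace J, mixtureLogLikRatio n J s z ≤
        mixtureLogLikRatio n J r z := ciSup_le fun s => by
      have := hmin s s.2
      rw [mixtureNegLogLik_eq hr, mixtureNegLogLik_eq s.2] at this
      linarith
    have hge := le_ciSup (hbdd w) ⟨r, hr⟩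
    simp only at hge
    linarith
  have hpq := (hfderiv hp hpmin).symm.trans (hfderiv hq hqmin)
  have hcard : (Finset.univ.image z).card = n := by
    rw [Finset.card_image_of_injective _ hinj, Finset.card_univ, Fintype.card_fin]
  obtain ⟨C, hC, h⟩ := exists_expSum_eq_mul (tiltedWeight_pos hp) (tiltedWeight_pos hq)
    (m := p.2) (v := q.2) (Z := Finset.univ.image z)
    (by rw [hcard, Fintype.card_fin, ← sq]; exact hJn) (by
      intro x hx
      obtain ⟨i, -, rfl⟩ := Finset.mem_image.1 hx
      simpa [Pi.single_apply] using DFunLike.congr_fun hpq (Pi.single i 1))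
  exact eq_of_expSum_tiltedWeight_eq hp hq hC h
end

section
/- Let n ≥ 1 and let z ∈ ℝ^n have pairwise distinct coordinates. Let K₁, K₂ ≥ 1 be integers with K₁·K₂ ≤ n. If (τ,μ) ∈ T_{K₁} and (ς,ν) ∈ T_{K₂} satisfy ∂Q_{K₁}(τ,μ,z)/∂z_i = ∂Q_{K₂}(ς,ν,z)/∂z_i for every i = 1,…,n, then K₁ = K₂, τ = ς, and μ = ν. -/
open MeasureTheory

/-- Rolle's theorem along a strictly increasing finite sequence of zeros. -/
theorem exists_strictMono_deriv_zeros {m : ℕ} {f f' : ℝ → ℝ} (hf : ∀ x, HasDerivAt f (f' x) x)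
    {x : Fin (m + 1) → ℝ} (hx : StrictMono x) (h0 : ∀ i, f (x i) = 0) :
    ∃ y : Fin m → ℝ, StrictMono y ∧ ∀ i, f' (y i) = 0 := by
  have key : ∀ i : Fin m, ∃ c ∈ Set.Ioo (x i.castSucc) (x i.succ), f' c = 0 := fun i =>
    exists_hasDerivAt_eq_zero (hx Fin.castSucc_lt_succ)
      (fun t _ => (hf t).continuousAt.continuousWithinAt) (by rw [h0, h0]) (fun t _ => hf t)
  choose y hy hy0 using key
  refine ⟨y, fun i j hij => ?_, hy0⟩
  calc y i < x i.succ := (hy i).2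
    _ ≤ x j.castSucc := hx.monotone (Fin.succ_le_castSucc_iff.2 hij)
    _ < y j := (hy j).1

theorem hasDerivAt_sum_mul_exp {ι : Type*} (s : Finset ι) (c e : ι → ℝ) (x : ℝ) :
    HasDerivAt (fun x => ∑ i ∈ s, c i * Real.exp (e i * x))
      (∑ i ∈ s, c i * e i * Real.exp (e i * x)) x := by
  refine HasDerivAt.fun_sum fun i _ => ?_
  have h := (((hasDerivAt_id x).const_mul (e i)).exp).const_mul (c i)
  refine h.congr_deriv ?_
  simp only [id]
  ring

/-- An exponential sum with `m` distinct exponents that vanishes at `m` distinct points has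
only zero coefficients. -/
theorem coeff_eq_zero_of_sum_mul_exp_eq_zero (s : Finset ℝ) :
    ∀ (c : ℝ → ℝ) (x : Fin s.card → ℝ), StrictMono x →
      (∀ i, ∑ a ∈ s, c a * Real.exp (a * x i) = 0) → ∀ a ∈ s, c a = 0 := by
  induction s using Finset.induction_on with
  | empty => simp
  | insert a₀ t ha₀ ih =>
    intro c x hx h0
    have hcard : (insert a₀ t).card = t.card + 1 := Finset.card_insert_of_notMem ha₀
    let x' : Fin (t.card + 1) → ℝ := fun i => x (Fin.cast hcard.symm i)
    have hx' : StrictMono x' := fun i j hij => hx (by simpa using hij)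
    have h0' : ∀ i, ∑ a ∈ insert a₀ t, c a * Real.exp ((a - a₀) * x' i) = 0 := by
      intro i
      have h := congrArg (· * Real.exp (-a₀ * x' i)) (h0 (Fin.cast hcard.symm i))
      simp only [zero_mul, Finset.sum_mul] at h
      rw [← h]
      refine Finset.sum_congr rfl fun a _ => ?_
      rw [mul_assoc, ← Real.exp_add]
      congr 2
      ring
    obtain ⟨y, hy, hy0⟩ := exists_strictMono_deriv_zeros
      (hasDerivAt_sum_mul_exp (insert a₀ t) c (fun a => a - a₀)) hx' h0'
    have ht : ∀ a ∈ t, c a = 0 := by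
      have h := ih (fun a => c a * (a - a₀)) y hy fun i => by
        have h := congrArg (· * Real.exp (a₀ * y i)) (hy0 i)
        simp only [zero_mul, Finset.sum_mul, Finset.sum_insert ha₀, sub_self, mul_zero,
          zero_add] at h
        rw [← h]
        refine Finset.sum_congr rfl fun a _ => ?_
        rw [mul_assoc _ (Real.exp _), ← Real.exp_add]
        congr 2
        ring
      intro a ha
      rcases mul_eq_zero.1 (h a ha) with h | h
      · exact h
      · exact absurd (sub_eq_zero.1 h ▸ ha) ha₀
    intro a ha
    rcases Finset.mem_insert.1 ha with rfl | ha
    · have h := h0' 0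
      rw [Finset.sum_insert ha₀, Finset.sum_eq_zero fun b hb => by rw [ht b hb, zero_mul]] at h
      simpa using h
    · exact ht a ha

/-- An exponential sum with `Fintype.card ι` terms (exponents not necessarily distinct) that
vanishes at that many distinct points has, for each exponent, total coefficient zero. -/
theorem sum_coeff_filter_eq_zero {ι : Type*} [Fintype ι] (c e : ι → ℝ) {n : ℕ} {z : Fin n → ℝ}
    (hz : Function.Injective z) (hn : Fintype.card ι ≤ n)
    (h0 : ∀ i, ∑ j, c j * Real.exp (e j * z i) = 0) (a : ℝ) :
    ∑ j with e j = a, c j = 0 := by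
  classical
  by_cases ha : a ∈ Finset.univ.image e
  · have hle : (Finset.univ.image e).card ≤ (Finset.univ.image z).card := by
      rw [Finset.card_image_of_injective _ hz, Finset.card_fin]
      exact Finset.card_image_le.trans hn
    refine coeff_eq_zero_of_sum_mul_exp_eq_zero (Finset.univ.image e)
      (fun a => ∑ j with e j = a, c j)
      (fun i => (Finset.univ.image z).orderEmbOfFin rfl (Fin.castLE hle i))
      (fun i j hij => by simpa using hij) (fun i => ?_) a ha
    obtain ⟨k, -, hk⟩ := Finset.mem_image.1
      ((Finset.univ.image z).orderEmbOfFin_mem rfl (Fin.castLE hle i))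
    rw [← hk, ← h0 k, ← Finset.sum_fiberwise_of_maps_to
      (fun j _ => Finset.mem_image_of_mem e (Finset.mem_univ j))]
    refine Finset.sum_congr rfl fun b _ => ?_
    rw [Finset.sum_mul]
    exact Finset.sum_congr rfl fun j hj => by rw [(Finset.mem_filter.1 hj).2]
  · refine Finset.sum_eq_zero fun j hj => absurd ?_ ha
    rw [← (Finset.mem_filter.1 hj).2]
    exact Finset.mem_image_of_mem e (Finset.mem_univ j)

/-- An exponential sum that vanishes at as many distinct points as it has terms is zero. -/
theorem sum_mul_exp_eq_zero {ι : Type*} [Fintype ι] (c e : ι → ℝ) {n : ℕ} {z : Fin n → ℝ}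
    (hz : Function.Injective z) (hn : Fintype.card ι ≤ n)
    (h0 : ∀ i, ∑ j, c j * Real.exp (e j * z i) = 0) (x : ℝ) :
    ∑ j, c j * Real.exp (e j * x) = 0 := by
  classical
  rw [← Finset.sum_fiberwise_of_maps_to (t := Finset.univ.image e)
      (fun j _ => Finset.mem_image_of_mem e (Finset.mem_univ j))]
  refine Finset.sum_eq_zero fun b _ => ?_
  rw [← zero_mul (Real.exp (b * x)), ← sum_coeff_filter_eq_zero c e hz hn h0 b, Finset.sum_mul]
  exact Finset.sum_congr rfl fun j hj => by rw [(Finset.mem_filter.1 hj).2]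

/-- The exponential sum `∑ j, c j * exp (e j * x)` determines, for each exponent, the total
coefficient. -/
theorem sum_filter_eq_of_sum_mul_exp_eq {ι κ : Type*} [Fintype ι] [Fintype κ]
    (c e : ι → ℝ) (d f : κ → ℝ)
    (h : ∀ x, ∑ j, c j * Real.exp (e j * x) = ∑ k, d k * Real.exp (f k * x)) (a : ℝ) :
    ∑ j with e j = a, c j = ∑ k with f k = a, d k := by
  have h0 : (∑ j, if e j = a then c j else 0) + ∑ k, (if f k = a then -d k else 0) = 0 := by
    have hsum := sum_coeff_filter_eq_zero (Sum.elim c (-d)) (Sum.elim e f)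
      (z := fun i : Fin (Fintype.card (ι ⊕ κ)) => ((i : ℕ) : ℝ))
      (fun i j hij => Fin.ext (Nat.cast_injective hij)) le_rfl
      (fun i => by simp [Fintype.sum_sum_type, h]) a
    rw [Finset.sum_filter, Fintype.sum_sum_type] at hsum
    exact hsum
  have hneg : ∑ k, (if f k = a then -d k else 0) = -∑ k, if f k = a then d k else 0 := by
    rw [← Finset.sum_neg_distrib]
    exact Finset.sum_congr rfl fun k _ => by split_ifs <;> simp
  rw [hneg] at h0
  rw [Finset.sum_filter, Finset.sum_filter]
  linarith

/-- Positive functions with equal logarithmic derivatives are proportional. -/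
theorem exists_pos_eq_mul_of_deriv_mul_eq {f g f' g' : ℝ → ℝ}
    (hf : ∀ x, HasDerivAt f (f' x) x) (hg : ∀ x, HasDerivAt g (g' x) x)
    (hf0 : ∀ x, 0 < f x) (hg0 : ∀ x, 0 < g x) (h : ∀ x, f' x * g x - f x * g' x = 0) :
    ∃ C, 0 < C ∧ ∀ x, f x = C * g x := by
  have hd : ∀ x, HasDerivAt (fun x => f x / g x) 0 x := fun x =>
    ((hf x).fun_div (hg x) (hg0 x).ne').congr_deriv (by rw [h, zero_div])
  refine ⟨f 0 / g 0, div_pos (hf0 0) (hg0 0), fun x => ?_⟩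
  have hconst := is_const_of_deriv_eq_zero (fun x => (hd x).differentiableAt) (fun x => (hd x).deriv) 0 x
  rw [hconst, div_mul_cancel₀ _ (hg0 x).ne']

theorem sum_mul_stdNormalPdf_eq {K : ℕ} (τ μ : Fin K → ℝ) (x : ℝ) :
    ∑ j, τ j * stdNormalPdf (x - μ j) =
      (Real.sqrt (2 * Real.pi))⁻¹ * Real.exp (-(x ^ 2) / 2) *
        ∑ j, τ j * Real.exp (-(μ j ^ 2) / 2) * Real.exp (μ j * x) := by
  rw [Finset.mul_sum]
  refine Finset.sum_congr rfl fun j _ => ?_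
  have : Real.exp (-((x - μ j) ^ 2) / 2) =
      Real.exp (-(x ^ 2) / 2) * Real.exp (-(μ j ^ 2) / 2) * Real.exp (μ j * x) := by
    rw [← Real.exp_add, ← Real.exp_add]
    congr 1
    ring
  rw [stdNormalPdf, this]
  ring

theorem sum_mul_exp_pos {K : ℕ} (hK : 1 ≤ K) {c : Fin K → ℝ} (hc : ∀ j, 0 < c j)
    (e : Fin K → ℝ) (x : ℝ) : 0 < ∑ j, c j * Real.exp (e j * x) :=
  Finset.sum_pos (fun j _ => mul_pos (hc j) (Real.exp_pos _)) ⟨⟨0, hK⟩, Finset.mem_univ _⟩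

theorem deriv_mixtureNegLogLik_update {n K : ℕ} (hK : 1 ≤ K) (τ μ : Fin K → ℝ)
    (hτ : ∀ j, 0 < τ j) (z : Fin n → ℝ) (i : Fin n) :
    deriv (fun w => mixtureNegLogLik n K (τ, μ) (Function.update z i w)) (z i) =
      z i - (∑ j, τ j * Real.exp (-(μ j ^ 2) / 2) * μ j * Real.exp (μ j * z i)) /
        ∑ j, τ j * Real.exp (-(μ j ^ 2) / 2) * Real.exp (μ j * z i) := by
  have hpos : ∀ x, 0 < ∑ j, τ j * Real.exp (-(μ j ^ 2) / 2) * Real.exp (μ j * x) :=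
    sum_mul_exp_pos hK (fun j => mul_pos (hτ j) (Real.exp_pos _)) μ
  have hc : (Real.sqrt (2 * Real.pi))⁻¹ ≠ 0 := by positivity
  have hsplit : (fun w => mixtureNegLogLik n K (τ, μ) (Function.update z i w)) = fun w =>
      w ^ 2 / 2 - Real.log (∑ j, τ j * Real.exp (-(μ j ^ 2) / 2) * Real.exp (μ j * w)) +
        (-Real.log (Real.sqrt (2 * Real.pi))⁻¹ -
          ∑ k ∈ Finset.univ.erase i, Real.log (∑ j, τ j * stdNormalPdf (z k - μ j))) := by
    funext w
    rw [mixtureNegLogLik, ← Finset.add_sum_erase _ _ (Finset.mem_univ i)]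
    have hrest : ∀ k ∈ Finset.univ.erase i,
        Real.log (∑ j, τ j * stdNormalPdf (Function.update z i w k - μ j)) =
          Real.log (∑ j, τ j * stdNormalPdf (z k - μ j)) := fun k hk => by
      rw [Function.update_of_ne (Finset.ne_of_mem_erase hk)]
    simp only [Function.update_self]
    rw [Finset.sum_congr rfl hrest, sum_mul_stdNormalPdf_eq,
      Real.log_mul (mul_ne_zero hc (Real.exp_pos _).ne') (hpos w).ne',
      Real.log_mul hc (Real.exp_pos _).ne', Real.log_exp]
    ring
  rw [hsplit]
  have hlog := (hasDerivAt_sum_mul_exp Finset.univ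
    (fun j => τ j * Real.exp (-(μ j ^ 2) / 2)) μ (z i)).log (hpos _).ne'
  have hsq := ((hasDerivAt_id (z i)).fun_pow 2).div_const 2
  refine (((hsq.fun_sub hlog).add_const _).congr_deriv ?_).deriv
  simp

/-- A normal location mixture, up to a Gaussian factor and a positive constant, determines its
ordered parameters. -/
theorem mixture_parameters_eq_of_sum_mul_exp_eq {K₁ K₂ : ℕ} {τ μ : Fin K₁ → ℝ}
    {ς ν : Fin K₂ → ℝ} (hτμ : (τ, μ) ∈ orderedMixtureSpace K₁)
    (hςν : (ς, ν) ∈ orderedMixtureSpace K₂) {C : ℝ} (hC : 0 < C)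
    (h : ∀ x, ∑ j, τ j * Real.exp (-(μ j ^ 2) / 2) * Real.exp (μ j * x) =
      C * ∑ k, ς k * Real.exp (-(ν k ^ 2) / 2) * Real.exp (ν k * x)) :
    ∃ h : K₁ = K₂, ∀ j : Fin K₁, τ j = ς (Fin.cast h j) ∧ μ j = ν (Fin.cast h j) := by
  obtain ⟨hτ, hτ1, hμ⟩ := hτμ
  obtain ⟨hς, hς1, hν⟩ := hςν
  simp only at hτ hτ1 hμ hς hς1 hν
  have hco := sum_filter_eq_of_sum_mul_exp_eq (fun j => τ j * Real.exp (-(μ j ^ 2) / 2)) μ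
    (fun k => C * (ς k * Real.exp (-(ν k ^ 2) / 2))) ν (fun x => by
      rw [h x, Finset.mul_sum]
      exact Finset.sum_congr rfl fun k _ => by ring)
  have hrange : Set.range μ = Set.range ν := by
    refine Set.Subset.antisymm ?_ ?_
    · rintro _ ⟨j, rfl⟩
      by_contra hj
      refine (Finset.sum_pos (fun j _ => mul_pos (hτ j) (Real.exp_pos _))
        ⟨j, by simp⟩).ne' ((hco (μ j)).trans (Finset.sum_eq_zero fun k hk => ?_))
      exact absurd ⟨k, (Finset.mem_filter.1 hk).2⟩ hj
    · rintro _ ⟨k, rfl⟩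
      by_contra hk
      refine (Finset.sum_pos (fun k _ => mul_pos hC (mul_pos (hς k) (Real.exp_pos _)))
        ⟨k, by simp⟩).ne' ((hco (ν k)).symm.trans (Finset.sum_eq_zero fun j hj => ?_))
      exact absurd ⟨j, (Finset.mem_filter.1 hj).2⟩ hk
  have hK : K₁ = K₂ := by
    have hcard := congrArg Set.ncard hrange
    rwa [Set.ncard_range_of_injective hμ.injective, Set.ncard_range_of_injective hν.injective,
      Nat.card_fin, Nat.card_fin] at hcard
  subst hK
  obtain rfl : μ = ν := (StrictMono.range_inj hμ hν).1 hrange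
  have hprop : ∀ j, τ j = C * ς j := by
    intro j
    have hj := hco (μ j)
    simp only [hμ.injective.eq_iff, Finset.filter_eq', Finset.mem_univ, if_true,
      Finset.sum_singleton, ← mul_assoc] at hj
    exact mul_right_cancel₀ (Real.exp_pos _).ne' hj
  have hC1 : C = 1 := by
    rw [Finset.sum_congr rfl fun j _ => hprop j, ← Finset.mul_sum, hς1, mul_one] at hτ1
    exact hτ1
  exact ⟨rfl, fun j => ⟨by rw [hprop j, hC1, one_mul]; rfl, rfl⟩⟩

/-- genericity verification in the proof of Theorem 1: the vector of
partial derivatives of the mixture negative log-likelihood with respect to the data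
points determines the mixture parameters. -/
theorem mixture_derivatives_determine_parameters (n : ℕ) (hn : 1 ≤ n)
    (z : Fin n → ℝ) (hz : Function.Injective z)
    (K₁ K₂ : ℕ) (hK₁ : 1 ≤ K₁) (hK₂ : 1 ≤ K₂) (hKn : K₁ * K₂ ≤ n)
    (τ μ : Fin K₁ → ℝ) (hτμ : (τ, μ) ∈ orderedMixtureSpace K₁)
    (ς ν : Fin K₂ → ℝ) (hςν : (ς, ν) ∈ orderedMixtureSpace K₂)
    (hder : ∀ i : Fin n,
      deriv (fun w => mixtureNegLogLik n K₁ (τ, μ) (Function.update z i w)) (z i) =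
      deriv (fun w => mixtureNegLogLik n K₂ (ς, ν) (Function.update z i w)) (z i)) :
    ∃ h : K₁ = K₂, ∀ j : Fin K₁, τ j = ς (Fin.cast h j) ∧ μ j = ν (Fin.cast h j) := by
  set f : ℝ → ℝ := fun x => ∑ j, τ j * Real.exp (-(μ j ^ 2) / 2) * Real.exp (μ j * x)
  set f' : ℝ → ℝ := fun x => ∑ j, τ j * Real.exp (-(μ j ^ 2) / 2) * μ j * Real.exp (μ j * x)
  set g : ℝ → ℝ := fun x => ∑ k, ς k * Real.exp (-(ν k ^ 2) / 2) * Real.exp (ν k * x)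
  set g' : ℝ → ℝ := fun x => ∑ k, ς k * Real.exp (-(ν k ^ 2) / 2) * ν k * Real.exp (ν k * x)
  have hf0 : ∀ x, 0 < f x :=
    sum_mul_exp_pos hK₁ (fun j => mul_pos (hτμ.1 j) (Real.exp_pos _)) μ
  have hg0 : ∀ x, 0 < g x :=
    sum_mul_exp_pos hK₂ (fun k => mul_pos (hςν.1 k) (Real.exp_pos _)) ν
  have hwronskian : ∀ x, f' x * g x - f x * g' x =
      ∑ p : Fin K₁ × Fin K₂, (τ p.1 * Real.exp (-(μ p.1 ^ 2) / 2)) *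
        (ς p.2 * Real.exp (-(ν p.2 ^ 2) / 2)) * (μ p.1 - ν p.2) *
          Real.exp ((μ p.1 + ν p.2) * x) := by
    intro x
    simp only [f, f', g, g', Fintype.sum_prod_type, Finset.sum_mul_sum,
      ← Finset.sum_sub_distrib]
    refine Finset.sum_congr rfl fun j _ => Finset.sum_congr rfl fun k _ => ?_
    rw [add_mul, Real.exp_add]
    ring
  have hzero : ∀ i, f' (z i) * g (z i) - f (z i) * g' (z i) = 0 := by
    intro i
    have h := hder i
    rw [deriv_mixtureNegLogLik_update hK₁ τ μ hτμ.1, deriv_mixtureNegLogLik_update hK₂ ς ν hςν.1,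
      sub_right_inj] at h
    have h' := (div_eq_div_iff (hf0 (z i)).ne' (hg0 (z i)).ne').1 h
    rw [sub_eq_zero, mul_comm (f (z i))]
    exact h'
  obtain ⟨C, hC, hfg⟩ := exists_pos_eq_mul_of_deriv_mul_eq
    (hasDerivAt_sum_mul_exp Finset.univ (fun j => τ j * Real.exp (-(μ j ^ 2) / 2)) μ)
    (hasDerivAt_sum_mul_exp Finset.univ (fun k => ς k * Real.exp (-(ν k ^ 2) / 2)) ν) hf0 hg0
    (fun x => (hwronskian x).trans (sum_mul_exp_eq_zero _ _ hz (by simpa using hKn)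
      (fun i => (hwronskian (z i)).symm.trans (hzero i)) x))
  exact mixture_parameters_eq_of_sum_mul_exp_eq hτμ hςν hC hfg
end

section
/- Let n, d be positive integers, let X be an n × d real matrix of rank d, and let B = ⋃_{j∈J} B_j where J is a finite or countable index set and each B_j ⊆ ℝ^d is locally compact in its subspace topology (for example, an embedded manifold, possibly with boundary or corner). Let p : B → ℝ be continuous on each B_j. Let Y be a random vector in ℝ^n whose distribution is absolutely continuous with respect to Lebesgue measure on ℝ^n. Then, almost surely, the penalized least-squares objective β ↦ (1/2)‖Y − Xβ‖² + p(β) has at most one global minimizer over B. -/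
open MeasureTheory

section

open Set Filter Topology

/-- A finite convex function on a subset of a finite-dimensional space is differentiable at almost
every interior point (Rademacher). -/
theorem ConvexOn.ae_differentiableAt_of_mem_interior {E : Type*} [NormedAddCommGroup E]
    [NormedSpace ℝ E] [FiniteDimensional ℝ E] [MeasurableSpace E] [BorelSpace E]
    (μ : Measure E) [μ.IsAddHaarMeasure] {C : Set E} {f : E → ℝ} (hf : ConvexOn ℝ C f) :
    ∀ᵐ y ∂μ, y ∈ interior C → DifferentiableAt ℝ f y := by
  have key : μ {y | y ∈ interior C ∧ ¬ DifferentiableAt ℝ f y} = 0 := by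
    refine measure_null_of_locally_null _ fun x hx => ?_
    obtain ⟨K, t, ht, hK⟩ := hf.locallyLipschitzOn_interior hx.1
    rw [isOpen_interior.nhdsWithin_eq hx.1] at ht
    refine ⟨_, inter_mem_nhdsWithin _ (interior_mem_nhds.2 ht), ?_⟩
    have h : ∀ᵐ y ∂μ, y ∈ t → DifferentiableWithinAt ℝ f t y := hK.ae_differentiableWithinAt_of_mem
    refine measure_mono_null (fun y hy => ?_) (ae_iff.1 h)
    exact fun hd => hy.1.2
      ((hd (interior_subset hy.2)).differentiableAt (mem_interior_iff_mem_nhds.1 hy.2))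
  rw [ae_iff]
  simpa only [Classical.not_imp] using key

/-- A supremum of affine functions, on the set where it is finite, is convex. -/
theorem convexOn_iSup_affine {E ι : Type*} [Nonempty ι] [NormedAddCommGroup E] [NormedSpace ℝ E]
    (a : ι → E →L[ℝ] ℝ) (c : ι → ℝ) :
    ConvexOn ℝ {y | BddAbove (range fun k => a k y - c k)} fun y => ⨆ k, (a k y - c k) := by
  have split : ∀ x y : E, ∀ s t : ℝ, s + t = 1 → ∀ k,
      a k (s • x + t • y) - c k = s * (a k x - c k) + t * (a k y - c k) := by
    intro x y s t hst k
    obtain rfl : t = 1 - s := by linarith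
    simp only [map_add, map_smul, smul_eq_mul]
    ring
  have le : ∀ x y : E, BddAbove (range fun k => a k x - c k) →
      BddAbove (range fun k => a k y - c k) → ∀ s t : ℝ, 0 ≤ s → 0 ≤ t → s + t = 1 → ∀ k,
      a k (s • x + t • y) - c k ≤ s * (⨆ k, (a k x - c k)) + t * (⨆ k, (a k y - c k)) := by
    intro x y hx hy s t hs ht hst k
    rw [split x y s t hst k]
    exact add_le_add (mul_le_mul_of_nonneg_left (le_ciSup hx k) hs)
      (mul_le_mul_of_nonneg_left (le_ciSup hy k) ht)
  refine ⟨fun x hx y hy s t hs ht hst => ?_, fun x hx y hy s t hs ht hst => ?_⟩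
  · exact ⟨_, forall_mem_range.2 (le x y hx hy s t hs ht hst)⟩
  · exact ciSup_le (le x y hx hy s t hs ht hst)

/-- For almost every point, all members of a family of affine functions that attain the pointwise
supremum there have the same linear part. -/
theorem ae_linear_part_eq_of_isMax {E ι : Type*} [NormedAddCommGroup E]
    [NormedSpace ℝ E] [FiniteDimensional ℝ E] [MeasurableSpace E] [BorelSpace E]
    (μ : Measure E) [μ.IsAddHaarMeasure] (a : ι → E →L[ℝ] ℝ) (c : ι → ℝ) :
    ∀ᵐ y ∂μ, ∀ i j, (∀ k, a k y - c k ≤ a i y - c i) → (∀ k, a k y - c k ≤ a j y - c j) →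
      a i = a j := by
  rcases isEmpty_or_nonempty ι with _ | _
  · exact Eventually.of_forall fun y i => isEmptyElim i
  have hconv := convexOn_iSup_affine a c
  set C := {y | BddAbove (range fun k => a k y - c k)}
  set φ : E → ℝ := fun y => ⨆ k, (a k y - c k)
  have hfr : ∀ᵐ y ∂μ, y ∉ frontier C :=
    measure_eq_zero_iff_ae_notMem.1 (hconv.1.addHaar_frontier μ)
  filter_upwards [hfr, hconv.ae_differentiableAt_of_mem_interior μ] with y hy hd i j hi hj
  have hint : y ∈ interior C := by
    by_contra h
    exact hy ⟨subset_closure ⟨_, forall_mem_range.2 hi⟩, h⟩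
  have hasF : ∀ i, (∀ k, a k y - c k ≤ a i y - c i) → fderiv ℝ φ y = a i := by
    intro i hi
    have hmin : IsLocalMin (fun z => φ z - a i z) y := by
      filter_upwards [mem_interior_iff_mem_nhds.1 hint] with z hz
      have h1 : a i z - c i ≤ φ z := le_ciSup hz i
      have h2 : φ y ≤ a i y - c i := ciSup_le hi
      linarith
    exact sub_eq_zero.1 (hmin.hasFDerivAt_eq_zero ((hd hint).hasFDerivAt.sub (a i).hasFDerivAt))
  rw [← hasF i hi, ← hasF j hj]

/-- A matrix whose rank is its number of columns acts injectively. -/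
theorem Matrix.mulVec_injective_of_rank_eq {n d : ℕ} {X : Matrix (Fin n) (Fin d) ℝ}
    (hX : X.rank = d) : Function.Injective X.mulVec := by
  have h := X.mulVecLin.finrank_range_add_finrank_ker
  rw [Module.finrank_fin_fun] at h
  have hr : Module.finrank ℝ X.mulVecLin.range = d := hX
  have hk : Module.finrank ℝ X.mulVecLin.ker = 0 := by omega
  exact LinearMap.ker_eq_bot.1 (Submodule.finrank_eq_zero.1 hk)

end

/-- Theorem 2: almost sure uniqueness of the penalized least-squares
estimator in linear regression with a possibly nonconvex penalty that is continuous on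
each piece `B j` of the (finite or countable) union `B = ⋃ j, B j` of locally compact
subsets of `ℝ^d`. -/
theorem penalized_least_squares_unique (n d : ℕ) (hn : 0 < n) (hd : 0 < d)
    (X : Matrix (Fin n) (Fin d) ℝ) (hX : X.rank = d)
    {J : Type*} [Countable J] (B : J → Set (Fin d → ℝ))
    (hloc : ∀ j, ∀ β ∈ B j, ∃ K : Set (Fin d → ℝ),
      K ⊆ B j ∧ IsCompact K ∧ K ∈ nhdsWithin β (B j))
    (p : (Fin d → ℝ) → ℝ) (hp : ∀ j, ContinuousOn p (B j))
    (P : Measure (Fin n → ℝ)) [IsProbabilityMeasure P] (hP : P ≪ volume) :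
    ∀ᵐ Y ∂P, ∀ β₁ ∈ ⋃ j, B j, ∀ β₂ ∈ ⋃ j, B j,
      (∀ β ∈ ⋃ j, B j,
        (1/2) * (∑ i, (Y i - X.mulVec β₁ i) ^ 2) + p β₁ ≤
        (1/2) * (∑ i, (Y i - X.mulVec β i) ^ 2) + p β) →
      (∀ β ∈ ⋃ j, B j,
        (1/2) * (∑ i, (Y i - X.mulVec β₂ i) ^ 2) + p β₂ ≤
        (1/2) * (∑ i, (Y i - X.mulVec β i) ^ 2) + p β) →
      β₁ = β₂ := by
  let a : (⋃ j, B j) → (Fin n → ℝ) →L[ℝ] ℝ := fun β =>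
    ∑ i, X.mulVec β i • ContinuousLinearMap.proj i
  have ha : ∀ β Y, a β Y = ∑ i, X.mulVec β i * Y i := by
    intro β Y
    simp [a]
  let c : (⋃ j, B j) → ℝ := fun β => (1/2) * (∑ i, (X.mulVec β i) ^ 2) + p β
  have hobj : ∀ (β : ⋃ j, B j) (Y : Fin n → ℝ),
      (1/2) * (∑ i, (Y i - X.mulVec β i) ^ 2) + p β =
        (1/2) * (∑ i, Y i ^ 2) - (a β Y - c β) := by
    intro β Y
    have hsq : ∀ i, (Y i - X.mulVec β i) ^ 2 =
        Y i ^ 2 - 2 * (X.mulVec β i * Y i) + X.mulVec β i ^ 2 := fun i => by ring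
    simp only [ha, c, hsq, Finset.sum_add_distrib, Finset.sum_sub_distrib, ← Finset.mul_sum]
    ring
  filter_upwards [hP.ae_le (ae_linear_part_eq_of_isMax volume a c)]
    with Y hY β₁ h₁ β₂ h₂ hmin₁ hmin₂
  have hmax : ∀ b : ⋃ j, B j, (∀ β ∈ ⋃ j, B j,
      (1/2) * (∑ i, (Y i - X.mulVec b i) ^ 2) + p b ≤
        (1/2) * (∑ i, (Y i - X.mulVec β i) ^ 2) + p β) → ∀ k, a k Y - c k ≤ a b Y - c b := by
    intro b hb k
    have h := hb k k.2
    rw [hobj b Y, hobj k Y] at h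
    linarith
  have heq := hY ⟨β₁, h₁⟩ ⟨β₂, h₂⟩ (hmax _ hmin₁) (hmax _ hmin₂)
  refine Matrix.mulVec_injective_of_rank_eq hX (funext fun i => ?_)
  simpa [ha, Pi.single_apply] using DFunLike.congr_fun heq (Pi.single i 1)
end

section
/- Let J be a finite or countable index set and for each j ∈ J let T_j be a second-countable Hausdorff C¹ manifold (without boundary) of dimension d_j; let T be the disjoint union of the T_j. Let f : T → ℝ^l be continuously differentiable on each T_j, and let (f_n) be a sequence of injective functions f_n : T → ℝ^l, each continuously differentiable on each T_j, converging to f uniformly on every compact subset of T. Call u ∈ ℝ^l a non-invertible value of f if there exist distinct t₁, t₂ ∈ T with f(t₁) = f(t₂) = u. Then the set of non-invertible values of f has Lebesgue measure zero in ℝ^l. -/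
open MeasureTheory
open scoped Manifold

section NullLagrangian

variable {E : Type*} [NormedAddCommGroup E] [NormedSpace ℝ E]

theorem det_smul_id_add_pos [FiniteDimensional ℝ E] (A : E →L[ℝ] E) {c : ℝ} (hc : ‖A‖ < c) :
    0 < (c • ContinuousLinearMap.id ℝ E + A).det := by
  have hc0 : 0 < c := (norm_nonneg A).trans_lt hc
  have hcont : Continuous fun s : ℝ => (c • ContinuousLinearMap.id ℝ E + s • A).det :=
    ContinuousLinearMap.continuous_det.comp (by fun_prop)
  have hne : ∀ s ∈ Set.Icc (0 : ℝ) 1, (c • ContinuousLinearMap.id ℝ E + s • A).det ≠ 0 := by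
    intro s hs h
    obtain ⟨v, hv, hv0⟩ := Submodule.exists_mem_ne_zero_of_ne_bot
      (LinearMap.bot_lt_ker_of_det_eq_zero h).ne'
    have h1 : c • v = -(s • A v) := by
      have : c • v + s • A v = 0 := by simpa using hv
      exact eq_neg_of_add_eq_zero_left this
    have h2 : c * ‖v‖ = s * ‖A v‖ := by
      simpa [norm_smul, abs_of_pos hc0, abs_of_nonneg hs.1] using congrArg norm h1
    have h3 : ‖A v‖ ≤ ‖A‖ * ‖v‖ := A.le_opNorm v
    have h4 : 0 < ‖v‖ := norm_pos_iff.2 hv0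
    have h5 : s * ‖A v‖ ≤ ‖A v‖ := mul_le_of_le_one_left (norm_nonneg _) hs.2
    nlinarith
  have h0 : 0 < (c • ContinuousLinearMap.id ℝ E + (0 : ℝ) • A).det := by
    have : (c • ContinuousLinearMap.id ℝ E + (0 : ℝ) • A).det = c ^ Module.finrank ℝ E := by
      simp [ContinuousLinearMap.det]
    rw [this]
    positivity
  by_contra hneg
  push Not at hneg
  obtain ⟨s, hs, hs0⟩ := intermediate_value_Icc' zero_le_one hcont.continuousOn
    ⟨by simpa using hneg, h0.le⟩
  exact hne s hs hs0

theorem bijective_smul_add [CompleteSpace E] {F : E → E} {K : NNReal} (hF : LipschitzWith K F)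
    {c : ℝ} (hc : K < c) : Function.Bijective fun x => c • x + F x := by
  have hc0 : 0 < c := K.coe_nonneg.trans_lt hc
  constructor
  · intro x y hxy
    have h1 : c • (x - y) = F y - F x := by
      simp only at hxy
      rw [smul_sub, sub_eq_sub_iff_add_eq_add, hxy, add_comm]
    have h2 : c * ‖x - y‖ = ‖F y - F x‖ := by
      simpa [norm_smul, abs_of_pos hc0] using congrArg norm h1
    have h3 := hF.norm_sub_le y x
    rw [norm_sub_rev y x] at h3
    by_contra hne
    have : 0 < ‖x - y‖ := norm_pos_iff.2 (sub_ne_zero.2 hne)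
    nlinarith
  · intro y
    lift c to NNReal using hc0.le
    have hcon : ContractingWith (K / c) fun x => (c : ℝ)⁻¹ • (y - F x) := by
      refine ⟨?_, LipschitzWith.of_dist_le_mul fun a b => ?_⟩
      · rw [← NNReal.coe_lt_coe]
        simpa using (div_lt_one hc0).2 hc
      · have h3 := hF.norm_sub_le b a
        rw [dist_eq_norm, dist_eq_norm, ← smul_sub, norm_smul, sub_sub_sub_cancel_left,
          norm_sub_rev a b, NNReal.coe_div, norm_inv, Real.norm_eq_abs, abs_of_pos hc0,
          div_mul_eq_mul_div, inv_mul_eq_div]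
        gcongr
    obtain ⟨x, hx, -⟩ := hcon.exists_fixedPoint 0 (edist_ne_top _ _)
    refine ⟨x, ?_⟩
    have hx' : (c : ℝ)⁻¹ • (y - F x) = x := hx
    have : (c : ℝ) • x = y - F x := by
      conv_lhs => rw [← hx']
      exact smul_inv_smul₀ hc0.ne' _
    simp [this]

variable [FiniteDimensional ℝ E]

/-- The determinant of an endomorphism is a fixed linear combination of the determinants of
its shifts by prescribed distinct scalars. -/
theorem det_eq_sum_det_smul_id_add (A : E →L[ℝ] E) {v : ℕ → ℝ} (hv : Function.Injective v) :
    A.det = ∑ i ∈ Finset.range (Module.finrank ℝ E + 1),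
      (v i • ContinuousLinearMap.id ℝ E + A).det *
        (Lagrange.basis (Finset.range (Module.finrank ℝ E + 1)) v i).eval 0 := by
  have heval : ∀ c : ℝ, (LinearMap.charpoly (-(A : E →ₗ[ℝ] E))).eval c =
      (c • ContinuousLinearMap.id ℝ E + A).det := by
    intro c
    rw [LinearMap.eval_charpoly, sub_neg_eq_add]
    rfl
  have h := Lagrange.eq_interpolate (s := Finset.range (Module.finrank ℝ E + 1)) (v := v)
    (f := LinearMap.charpoly (-(A : E →ₗ[ℝ] E))) hv.injOn (by
      refine Polynomial.degree_le_natDegree.trans_lt ?_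
      rw [LinearMap.charpoly_natDegree, Finset.card_range]
      exact_mod_cast Nat.lt_succ_self _)
  have h0 := congrArg (Polynomial.eval 0) h
  rw [Lagrange.interpolate_apply, Polynomial.eval_finsetSum, heval] at h0
  simpa [heval] using h0

variable [MeasurableSpace E] [BorelSpace E] (μ : Measure E) [μ.IsAddHaarMeasure]

theorem setIntegral_det_fderiv_smul_add {F : E → E} (hF : ContDiff ℝ 1 F) {K : NNReal}
    (hK : LipschitzWith K F) {c : ℝ} (hc : K < c) {s : Set E} (hs : MeasurableSet s) :
    ∫ x in s, (c • ContinuousLinearMap.id ℝ E + fderiv ℝ F x).det ∂μ =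
      μ.real ((fun x => c • x + F x) '' s) := by
  have h := integral_image_eq_integral_abs_det_fderiv_smul μ hs
    (f := fun x => c • x + F x) (f' := fun x => c • ContinuousLinearMap.id ℝ E + fderiv ℝ F x)
    (fun x _ => (((hasFDerivAt_id x).const_smul c).add
      (hF.differentiable one_ne_zero x).hasFDerivAt).hasFDerivWithinAt)
    (bijective_smul_add hK hc).injective.injOn (fun _ => (1 : ℝ))
  simp only [integral_const, smul_eq_mul, mul_one, measureReal_restrict_apply_univ] at h
  rw [h]
  refine integral_congr_ae (Filter.Eventually.of_forall fun x => ?_)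
  exact (abs_of_pos (det_smul_id_add_pos _
    ((norm_fderiv_le_of_lipschitz ℝ hK).trans_lt hc))).symm

/-- The Jacobian determinant is a null Lagrangian: its integral over a bounded set only depends
on the values of the map outside the set. -/
theorem setIntegral_det_fderiv_eq_of_eqOn_compl {F G : E → E} (hF : ContDiff ℝ 1 F)
    (hG : ContDiff ℝ 1 G) {K : NNReal} (hFK : LipschitzWith K F) (hGK : LipschitzWith K G)
    {s : Set E} (hs : IsCompact s) (hFG : Set.EqOn F G sᶜ) :
    ∫ x in s, (fderiv ℝ F x).det ∂μ = ∫ x in s, (fderiv ℝ G x).det ∂μ := by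
  have himage : ∀ c : ℝ, K < c →
      (fun x => c • x + F x) '' s = (fun x => c • x + G x) '' s := by
    intro c hc
    rw [← compl_inj_iff, ← Set.image_compl_eq (bijective_smul_add hFK hc),
      ← Set.image_compl_eq (bijective_smul_add hGK hc)]
    exact Set.image_congr fun x hx => by rw [hFG hx]
  have hv : Function.Injective fun i : ℕ => (K : ℝ) + 1 + i := by
    intro i j hij
    simpa using hij
  have hlt : ∀ i : ℕ, (K : ℝ) < K + 1 + i := fun i => by
    linarith [(Nat.cast_nonneg i : (0 : ℝ) ≤ i)]
  have key : ∀ H : E → E, ContDiff ℝ 1 H → LipschitzWith K H →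
      ∫ x in s, (fderiv ℝ H x).det ∂μ = ∑ i ∈ Finset.range (Module.finrank ℝ E + 1),
        μ.real ((fun x => ((K : ℝ) + 1 + i) • x + H x) '' s) *
          (Lagrange.basis (Finset.range (Module.finrank ℝ E + 1))
            (fun i : ℕ => (K : ℝ) + 1 + i) i).eval 0 := by
    intro H hH hHK
    have hcont := hH.continuous_fderiv one_ne_zero
    have hint : ∀ c : ℝ,
        IntegrableOn (fun x => (c • ContinuousLinearMap.id ℝ E + fderiv ℝ H x).det) s μ :=
      fun c => (ContinuousLinearMap.continuous_det.comp
        (by fun_prop)).continuousOn.integrableOn_compact hs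
    rw [integral_congr_ae (Filter.Eventually.of_forall fun x =>
      det_eq_sum_det_smul_id_add (fderiv ℝ H x) hv),
      integral_finsetSum _ fun i _ => (hint _).mul_const _]
    refine Finset.sum_congr rfl fun i _ => ?_
    rw [integral_mul_const, setIntegral_det_fderiv_smul_add μ hH hHK (hlt i) hs.measurableSet]
  rw [key F hF hFK, key G hG hGK]
  exact Finset.sum_congr rfl fun i _ => by rw [himage _ (hlt i)]

end NullLagrangian

/-- A `C¹` map which is close to the identity on a closed ball attains the centre of the ball. -/
theorem exists_mem_closedBall_eq_zero_of_norm_sub_le {l : ℕ} {h : (Fin l → ℝ) → (Fin l → ℝ)}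
    {V : Set (Fin l → ℝ)} (hV : IsOpen V) {r : ℝ} (hr : 0 < r)
    (hrV : Metric.closedBall 0 r ⊆ V) (hh : ContDiffOn ℝ 1 h V)
    (hclose : ∀ x ∈ Metric.closedBall 0 r, ‖h x - x‖ ≤ r / 2) :
    ∃ x ∈ Metric.closedBall 0 r, h x = 0 := by
  by_contra! hne
  let χ : ContDiffBump (0 : Fin l → ℝ) := ⟨3 * r / 4, r, by linarith, by linarith⟩
  let g : (Fin l → ℝ) → (Fin l → ℝ) := fun x => χ x • (h x - x)
  have hg : ContDiff ℝ 1 g := by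
    rw [contDiff_iff_contDiffAt]
    intro x
    by_cases hx : x ∈ V
    · exact (χ.contDiff (n := 1)).contDiffAt.smul
        ((hh.contDiffAt (hV.mem_nhds hx)).sub contDiffAt_id)
    · have hx' : x ∉ tsupport χ := by
        rw [χ.tsupport_eq]
        exact fun hx' => hx (hrV hx')
      have : g =ᶠ[nhds x] fun _ => 0 := by
        filter_upwards [notMem_tsupport_iff_eventuallyEq.1 hx'] with y hy
        simp [g, hy]
      exact contDiffAt_const.congr_of_eventuallyEq this
  have hgs : ∀ x ∉ Metric.closedBall (0 : Fin l → ℝ) r, g x = 0 := by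
    intro x hx
    have : χ x = 0 := χ.zero_of_le_dist (not_le.1 hx).le
    simp [g, this]
  let H : (Fin l → ℝ) → (Fin l → ℝ) := fun x => x + g x
  have hH : ContDiff ℝ 1 H := contDiff_id.add hg
  have hH0 : ∀ x ∈ Metric.closedBall (0 : Fin l → ℝ) r, H x ≠ 0 := by
    intro x hx h0
    have hχ := χ.nonneg (x := x)
    rcases le_or_gt ‖x‖ (3 * r / 4) with hx1 | hx1
    · have : χ x = 1 := χ.one_of_mem_closedBall (by simpa using hx1)
      exact hne x hx (by simpa [H, g, this] using h0)
    · have h1 : ‖x‖ = ‖g x‖ := by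
        have := congrArg norm (eq_neg_of_add_eq_zero_left h0)
        rwa [norm_neg] at this
      have h2 : ‖g x‖ ≤ 1 * (r / 2) := by
        simp only [g, norm_smul, Real.norm_eq_abs, abs_of_nonneg hχ]
        exact mul_le_mul χ.le_one (hclose x hx) (norm_nonneg _) zero_le_one
      linarith
  obtain ⟨x₀, hx₀, hmin⟩ := (isCompact_closedBall (0 : Fin l → ℝ) r).exists_isMinOn
    ⟨0, by simpa using hr.le⟩ hH.continuous.norm.continuousOn
  let δ : NNReal := ‖H x₀‖₊
  have hδ : 0 < (δ : ℝ) := norm_pos_iff.2 (hH0 x₀ hx₀)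
  let b : ℝ → ℝ := fun t => max 0 (δ - |t|)
  have hb : Continuous b := by fun_prop
  let θ : ℝ → ℝ := fun t => ∫ s in (0 : ℝ)..t, b s
  have hθ : ∀ t, HasDerivAt θ (b t) t := fun t => (hb.integral_hasStrictDerivAt 0 t).hasDerivAt
  have hθd : deriv θ = b := funext fun t => (hθ t).deriv
  have hθC : ContDiff ℝ 1 θ :=
    contDiff_one_iff_deriv.2 ⟨fun t => (hθ t).differentiableAt, hθd ▸ hb⟩
  have hθL : LipschitzWith δ θ := by
    refine lipschitzWith_of_nnnorm_deriv_le (fun t => (hθ t).differentiableAt) fun t => ?_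
    rw [hθd, ← NNReal.coe_le_coe, coe_nnnorm, Real.norm_eq_abs, abs_of_nonneg (le_max_left _ _)]
    exact max_le hδ.le (by linarith [abs_nonneg t])
  let ρ : (Fin l → ℝ) → (Fin l → ℝ) := fun y i => θ (y i)
  have hρC : ContDiff ℝ 1 ρ := contDiff_pi.2 fun i => hθC.comp (contDiff_apply ℝ ℝ i)
  have hρL : LipschitzWith δ ρ := LipschitzWith.of_dist_le_mul fun x y =>
    (dist_pi_le_iff (by positivity)).2 fun i => (hθL.dist_le_mul _ _).trans
      (mul_le_mul_of_nonneg_left (dist_le_pi_dist x y i) hδ.le)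
  have hρdet : ∀ y, (fderiv ℝ ρ y).det = ∏ i, b (y i) := by
    intro y
    have : HasFDerivAt ρ (ContinuousLinearMap.pi fun i =>
        (b (y i) • ContinuousLinearMap.id ℝ ℝ) ∘SL
          (ContinuousLinearMap.proj i : (Fin l → ℝ) →L[ℝ] ℝ)) y := by
      refine hasFDerivAt_pi.2 fun i => ?_
      have h1 := (hθ (y i)).hasFDerivAt.comp y (hasFDerivAt_apply (𝕜 := ℝ) i y)
      have h2 : (b (y i) • ContinuousLinearMap.id ℝ ℝ) =
          ContinuousLinearMap.toSpanSingleton ℝ (b (y i)) := by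
        ext
        simp
      rw [h2]
      exact h1
    rw [this.fderiv, ContinuousLinearMap.det_pi]
    simp [ContinuousLinearMap.det]
  have hFG : Set.EqOn (ρ ∘ H) ρ (Metric.closedBall 0 r)ᶜ := fun x hx => by
    simp [H, hgs x hx]
  obtain ⟨C, hC⟩ : ∃ C, LipschitzWith C (ρ ∘ H - ρ) :=
    ((hρC.comp hH).sub hρC).lipschitzWith_of_hasCompactSupport
      (HasCompactSupport.intro (isCompact_closedBall 0 r) fun x hx =>
        sub_eq_zero.2 (hFG hx)) one_ne_zero
  have hFL : LipschitzWith (δ + C) (ρ ∘ H) := by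
    have h := hρL.add hC
    simp only [Pi.sub_apply, add_sub_cancel] at h
    exact h
  have hint := setIntegral_det_fderiv_eq_of_eqOn_compl volume (hρC.comp hH) hρC hFL
    (hρL.weaken le_self_add) (isCompact_closedBall 0 r) hFG
  rw [setIntegral_eq_zero_of_forall_eq_zero fun x hx => ?_] at hint
  · have hcont : Continuous fun x : Fin l → ℝ => ∏ i, b (x i) := by fun_prop
    simp_rw [hρdet] at hint
    have hae := (setIntegral_eq_zero_iff_of_nonneg_ae
      (Filter.Eventually.of_forall fun x => Finset.prod_nonneg fun i _ => le_max_left _ _)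
      (hcont.continuousOn.integrableOn_compact (isCompact_closedBall 0 r))).1 hint.symm
    have hnull := (ae_restrict_iff' measurableSet_closedBall).1 hae
    have hpos := Metric.measure_ball_pos volume (0 : Fin l → ℝ) (lt_min hr hδ)
    refine hpos.ne' (measure_mono_null (fun x hx => ?_) hnull)
    intro hx0
    rw [mem_ball_zero_iff, lt_min_iff] at hx
    refine (Finset.prod_pos fun i _ => ?_).ne' (hx0 (by simpa using hx.1.le))
    have := (norm_le_pi_norm x i).trans_lt hx.2
    exact lt_max_of_lt_right (by simpa using this)
  · have hd := fderiv_comp x (hρC.differentiable one_ne_zero (H x))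
      (hH.differentiable one_ne_zero x)
    rw [hd]
    have : (fderiv ℝ ρ (H x)).det = 0 := by
      rw [hρdet]
      have hx' : ¬ ‖H x‖ < δ := not_lt.2 (hmin hx)
      rw [pi_norm_lt_iff hδ] at hx'
      push Not at hx'
      obtain ⟨i, hi⟩ := hx'
      exact Finset.prod_eq_zero (Finset.mem_univ i) (max_eq_left (by simpa using hi))
    have hmul : (fderiv ℝ ρ (H x) ∘SL fderiv ℝ H x).det =
        (fderiv ℝ ρ (H x)).det * (fderiv ℝ H x).det := LinearMap.det_comp _ _
    rw [hmul, this, zero_mul]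

/-- A value taken at a point where the derivative is surjective is also taken, near that point,
by all sufficiently close `C¹` approximations. -/
theorem eventually_exists_eq_of_surjective_fderiv {E : Type*} [NormedAddCommGroup E]
    [NormedSpace ℝ E] {l : ℕ} {f : E → (Fin l → ℝ)} {fn : ℕ → E → (Fin l → ℝ)} {V : Set E}
    (hV : IsOpen V) {y : E} (hy : y ∈ V) {A : E →L[ℝ] (Fin l → ℝ)} (hf : HasFDerivAt f A y)
    (hA : Function.Surjective A) (hfn : ∀ n, ContDiffOn ℝ 1 (fn n) V)
    (hconv : ∀ K ⊆ V, IsCompact K → TendstoUniformlyOn fn f Filter.atTop K) :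
    ∀ᶠ n in Filter.atTop, ∃ x ∈ V, fn n x = f y := by
  obtain ⟨B, hB⟩ := A.exists_rightInverse_of_surjective (LinearMap.range_eq_top.2 hA)
  let p : (Fin l → ℝ) → E := fun z => y + B z
  have hp : ContDiff ℝ 1 p := contDiff_const.add B.contDiff
  have hp0 : p 0 = y := by simp [p]
  have hfp : HasFDerivAt (f ∘ p) (ContinuousLinearMap.id ℝ (Fin l → ℝ)) 0 := by
    rw [← hB]
    exact HasFDerivAt.comp 0 (by rwa [hp0]) (B.hasFDerivAt.const_add y)
  have hclose := (hasFDerivAt_iff_isLittleO_nhds_zero.1 hfp).bound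
    (show (0 : ℝ) < 1 / 4 by norm_num)
  have hVp : IsOpen (p ⁻¹' V) := hV.preimage hp.continuous
  obtain ⟨r, hr, hball⟩ := Metric.nhds_basis_closedBall.mem_iff.1
    (Filter.inter_mem hclose (hVp.mem_nhds (show p 0 ∈ V by rwa [hp0])))
  have hunif := Metric.tendstoUniformlyOn_iff.1 (hconv (p '' Metric.closedBall 0 r)
    (Set.image_subset_iff.2 fun z hz => (hball hz).2)
    ((isCompact_closedBall 0 r).image hp.continuous)) (r / 4) (by linarith)
  filter_upwards [hunif] with n hn
  obtain ⟨z, hz, hz0⟩ := exists_mem_closedBall_eq_zero_of_norm_sub_le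
    (h := fun z => fn n (p z) - f y) hVp hr (fun z hz => (hball hz).2)
    (((hfn n).comp hp.contDiffOn fun z hz => hz).sub contDiffOn_const) fun z hz => by
      have h1 := (hball hz).1
      have h2 := hn (p z) ⟨z, hz, rfl⟩
      simp only [Set.mem_ofPred_eq, zero_add, Function.comp_apply, hp0,
        ContinuousLinearMap.id_apply] at h1
      rw [dist_comm, dist_eq_norm] at h2
      have h3 : ‖z‖ ≤ r := by simpa using hz
      calc ‖fn n (p z) - f y - z‖ = ‖(fn n (p z) - f (p z)) + (f (p z) - f y - z)‖ := by
            congr 1; abel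
        _ ≤ _ := norm_add_le _ _
        _ ≤ r / 2 := by linarith
  exact ⟨p z, (hball hz).2, sub_eq_zero.1 hz0⟩

/-- An injective `C¹` map defined on a nonempty open set does not lower the dimension. -/
theorem finrank_le_finrank_of_contDiffOn_of_injOn {E F : Type*} [NormedAddCommGroup E]
    [NormedSpace ℝ E] [FiniteDimensional ℝ E] [NormedAddCommGroup F] [NormedSpace ℝ F]
    [FiniteDimensional ℝ F] {U : Set E} (hU : IsOpen U) (hne : U.Nonempty) {g : E → F}
    (hg : ContDiffOn ℝ 1 g U) (hinj : Set.InjOn g U) :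
    Module.finrank ℝ E ≤ Module.finrank ℝ F := by
  by_contra! hlt
  let rk : E → ℕ := fun x => Module.finrank ℝ (LinearMap.range (fderiv ℝ g x : E →ₗ[ℝ] F))
  have hbdd : BddAbove (rk '' U) :=
    ⟨Module.finrank ℝ F, by rintro _ ⟨x, -, rfl⟩; exact Submodule.finrank_le _⟩
  obtain ⟨x₀, hx₀, hmax⟩ : ∃ x₀ ∈ U, ∀ x ∈ U, rk x ≤ rk x₀ := by
    obtain ⟨x₀, hx₀, h⟩ := Nat.sSup_mem (hne.image rk) hbdd
    exact ⟨x₀, hx₀, fun x hx => h ▸ le_csSup hbdd ⟨x, hx, rfl⟩⟩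
  let L : E →ₗ[ℝ] F := (fderiv ℝ g x₀ : E →ₗ[ℝ] F)
  obtain ⟨w, hw, hw0⟩ := Submodule.exists_mem_ne_zero_of_ne_bot
    (LinearMap.ker_ne_bot_of_finrank_lt (f := L) hlt)
  obtain ⟨P', hP'⟩ := (LinearMap.range L).subtype.exists_leftInverse_of_injective
    (LinearMap.range L).ker_subtype
  obtain ⟨Q', hQ'⟩ := (LinearMap.ker L).subtype.exists_leftInverse_of_injective
    (LinearMap.ker L).ker_subtype
  let P := LinearMap.toContinuousLinearMap P'
  let Q := LinearMap.toContinuousLinearMap Q'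
  have hP : ∀ v : LinearMap.range L, P v = v := fun v => LinearMap.congr_fun hP' v
  have hQ : ∀ v : LinearMap.ker L, Q v = v := fun v => LinearMap.congr_fun hQ' v
  let Ψ : E → LinearMap.range L × LinearMap.ker L := fun x => (P (g x), Q x)
  have hgd : ∀ x ∈ U, HasFDerivAt g (fderiv ℝ g x) x := fun x hx =>
    ((hg.contDiffAt (hU.mem_nhds hx)).differentiableAt one_ne_zero).hasFDerivAt
  have hΨd : ∀ x ∈ U, HasFDerivAt Ψ ((P ∘L fderiv ℝ g x).prod Q) x := fun x hx =>
    (P.hasFDerivAt.comp x (hgd x hx)).prodMk Q.hasFDerivAt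
  have hΨC : ContDiffAt ℝ 1 Ψ x₀ :=
    (P.contDiff.contDiffAt.comp x₀ (hg.contDiffAt (hU.mem_nhds hx₀))).prodMk
      Q.contDiff.contDiffAt
  have hDinj : Function.Injective
      ((P ∘L fderiv ℝ g x₀).prod Q : E →ₗ[ℝ] LinearMap.range L × LinearMap.ker L) := by
    refine (injective_iff_map_eq_zero _).2 fun v hv => ?_
    obtain ⟨h1, h2⟩ := Prod.ext_iff.1 hv
    have h3 : (⟨L v, LinearMap.mem_range_self L v⟩ : LinearMap.range L) = 0 := by
      rw [← hP ⟨L v, LinearMap.mem_range_self L v⟩]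
      exact h1
    have h4 : (⟨v, LinearMap.mem_ker.2 (congrArg Subtype.val h3)⟩ : LinearMap.ker L) = 0 := by
      rw [← hQ ⟨v, _⟩]
      exact h2
    exact congrArg Subtype.val h4
  let e := (LinearEquiv.ofInjectiveOfFinrankEq _ hDinj (by
    rw [Module.finrank_prod, LinearMap.finrank_range_add_finrank_ker])).toContinuousLinearEquiv
  have he : HasFDerivAt Ψ (e : E →L[ℝ] _) x₀ := hΨd x₀ hx₀
  let S := hΨC.localInverse he one_ne_zero
  have hS : ContDiffAt ℝ 1 S (Ψ x₀) := hΨC.to_localInverse he one_ne_zero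
  have hS0 : S (Ψ x₀) = x₀ := hΨC.localInverse_apply_image he one_ne_zero
  have hright : ∀ᶠ q in nhds (Ψ x₀), Ψ (S q) = q :=
    (hΨC.hasStrictFDerivAt' he one_ne_zero).eventually_right_inverse
  let q : ℝ → LinearMap.range L × LinearMap.ker L := fun s => Ψ x₀ + s • (0, ⟨w, hw⟩)
  have hq : Continuous q := by fun_prop
  have hq0 : q 0 = Ψ x₀ := by simp [q]
  have hev : ∀ᶠ s in nhds (0 : ℝ), DifferentiableAt ℝ S (q s) ∧ S (q s) ∈ U ∧
      ∀ᶠ q' in nhds (q s), Ψ (S q') = q' := by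
    refine hq.continuousAt.eventually (p := fun q => DifferentiableAt ℝ S q ∧ S q ∈ U ∧
      ∀ᶠ q' in nhds q, Ψ (S q') = q') ?_
    rw [hq0]
    filter_upwards [hS.eventually (by simp), hright.eventually_nhds,
      hS.continuousAt.eventually_mem (hU.mem_nhds (by rwa [hS0]))] with q h1 h2 h3
    exact ⟨h1.differentiableAt one_ne_zero, h3, h2⟩
  obtain ⟨ε, hε, hball⟩ := Metric.eventually_nhds_iff_ball.1 hev
  have hderiv : ∀ s ∈ Metric.ball (0 : ℝ) ε, HasDerivAt (fun s => g (S (q s))) 0 s := by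
    intro s hs
    obtain ⟨hSd, hSU, hSr⟩ := hball s hs
    have hcomp : ((P ∘L fderiv ℝ g (S (q s))).prod Q) ∘L fderiv ℝ S (q s) =
        ContinuousLinearMap.id ℝ _ :=
      ((hΨd _ hSU).comp (q s) hSd.hasFDerivAt).unique
        ((hasFDerivAt_id (q s)).congr_of_eventuallyEq hSr)
    set D := fderiv ℝ g (S (q s)) with hD
    let PD : LinearMap.range (D : E →ₗ[ℝ] F) →ₗ[ℝ] LinearMap.range L :=
      P' ∘ₗ (LinearMap.range (D : E →ₗ[ℝ] F)).subtype
    have hPDsurj : Function.Surjective PD := by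
      intro v
      refine ⟨⟨D (fderiv ℝ S (q s) (v, 0)), LinearMap.mem_range_self _ _⟩, ?_⟩
      exact congrArg Prod.fst (DFunLike.congr_fun hcomp (v, 0))
    have hPDinj : Function.Injective PD :=
      (LinearMap.injective_iff_surjective_of_finrank_eq_finrank
        ((hmax _ hSU).antisymm (LinearMap.finrank_le_finrank_of_surjective hPDsurj))).2 hPDsurj
    have hzero : D (fderiv ℝ S (q s) (0, ⟨w, hw⟩)) = 0 := by
      have h1 : PD ⟨D (fderiv ℝ S (q s) (0, ⟨w, hw⟩)), LinearMap.mem_range_self _ _⟩ = 0 :=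
        congrArg Prod.fst (DFunLike.congr_fun hcomp (0, (⟨w, hw⟩ : LinearMap.ker L)))
      exact congrArg Subtype.val ((injective_iff_map_eq_zero PD).1 hPDinj _ h1)
    have hqd : HasDerivAt q (0, ⟨w, hw⟩) s := by
      have h := ((hasDerivAt_id s).smul_const
        ((0, ⟨w, hw⟩) : LinearMap.range L × LinearMap.ker L)).const_add (Ψ x₀)
      rw [one_smul] at h
      exact h
    have h := (hgd _ hSU).comp_hasDerivAt s (hSd.hasFDerivAt.comp_hasDerivAt s hqd)
    rw [← hD, hzero] at h
    exact h
  obtain ⟨a, ha⟩ := Metric.isOpen_ball.exists_is_const_of_deriv_eq_zero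
    (convex_ball (0 : ℝ) ε).isPreconnected
    (fun s hs => (hderiv s hs).differentiableAt.differentiableWithinAt)
    (fun s hs => (hderiv s hs).deriv)
  have h0 : (0 : ℝ) ∈ Metric.ball (0 : ℝ) ε := Metric.mem_ball_self hε
  have h1 : ε / 2 ∈ Metric.ball (0 : ℝ) ε := by
    simp [abs_of_pos hε, hε]
  have h2 : S (q 0) = S (q (ε / 2)) :=
    hinj (hball _ h0).2.1 (hball _ h1).2.1 ((ha _ h0).trans (ha _ h1).symm)
  have h3 : q 0 = q (ε / 2) := by
    rw [← (hball _ h0).2.2.self_of_nhds, h2, (hball _ h1).2.2.self_of_nhds]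
  have h4 : (ε / 2) • w = 0 := by
    have := congrArg (fun p => ((p.2 : LinearMap.ker L) : E)) h3
    simpa [q] using this
  exact hw0 ((smul_eq_zero.1 h4).resolve_left (by positivity))

/-- The critical values of a map into `ℝ^l` from a space of dimension at most `l` form a
null set. -/
theorem volume_image_eq_zero_of_not_surjective_fderiv {E : Type*} [NormedAddCommGroup E]
    [NormedSpace ℝ E] [FiniteDimensional ℝ E] {l : ℕ} (hl : Module.finrank ℝ E ≤ l)
    {f : E → (Fin l → ℝ)} {f' : E → E →L[ℝ] (Fin l → ℝ)} {s : Set E}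
    (hf : ∀ x ∈ s, HasFDerivAt f (f' x) x) (hf' : ∀ x ∈ s, ¬ Function.Surjective (f' x)) :
    volume (f '' s) = 0 := by
  let b := Module.finBasis ℝ E
  let π := LinearMap.toContinuousLinearMap
    (b.equivFun.symm.toLinearMap ∘ₗ LinearMap.funLeft ℝ ℝ (Fin.castLE hl))
  have hπ : Function.Surjective π := b.equivFun.symm.surjective.comp
    (LinearMap.funLeft_surjective_of_injective ℝ ℝ _ (Fin.castLE_injective hl))
  have himage : f '' s = (f ∘ π) '' (π ⁻¹' s) := by
    rw [Set.image_comp, Set.image_preimage_eq s hπ]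
  rw [himage]
  refine addHaar_image_eq_zero_of_det_fderivWithin_eq_zero volume
    (f' := fun z => f' (π z) ∘L π)
    (fun z hz => ((hf _ hz).comp z π.hasFDerivAt).hasFDerivWithinAt) fun z hz => ?_
  by_contra hdet
  have hsurj : Function.Surjective (f' (π z) ∘L π) :=
    (LinearMap.equivOfDetNeZero _ hdet).surjective
  exact hf' _ hz (Function.Surjective.of_comp hsurj)

/-- Lemma 7: if `f : T → ℝ^l`, defined on a finite or countable
disjoint union of second-countable Hausdorff C¹ manifolds (without boundary), is C¹ on
each component and is the locally uniform limit of injective C¹ maps, then the set of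
non-invertible values of `f` has Lebesgue measure zero. -/
theorem noninvertible_values_measure_zero
    {J : Type*} [Countable J] (dj : J → ℕ) (l : ℕ)
    (T : J → Type*) [∀ j, TopologicalSpace (T j)] [∀ j, T2Space (T j)]
    [∀ j, SecondCountableTopology (T j)]
    [∀ j, ChartedSpace (EuclideanSpace ℝ (Fin (dj j))) (T j)]
    [∀ j, HasGroupoid (T j) (contDiffGroupoid 1 (𝓡 (dj j)))]
    (f : (Σ j, T j) → (Fin l → ℝ))
    (hf : ∀ j, ContMDiff (𝓡 (dj j)) 𝓘(ℝ, Fin l → ℝ) 1 (fun x : T j => f ⟨j, x⟩))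
    (fn : ℕ → (Σ j, T j) → (Fin l → ℝ))
    (hfn_inj : ∀ n, Function.Injective (fn n))
    (hfn_C1 : ∀ n j, ContMDiff (𝓡 (dj j)) 𝓘(ℝ, Fin l → ℝ) 1 (fun x : T j => fn n ⟨j, x⟩))
    (hconv : ∀ K : Set (Σ j, T j), IsCompact K →
      TendstoUniformlyOn fn f Filter.atTop K) :
    volume {u : Fin l → ℝ |
      ∃ t₁ t₂ : Σ j, T j, t₁ ≠ t₂ ∧ f t₁ = u ∧ f t₂ = u} = 0 := by
  have hmfd : ∀ j, IsManifold (𝓡 (dj j)) 1 (T j) := fun j => ⟨⟩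
  let φ : ∀ (j : J), T j → EuclideanSpace ℝ (Fin (dj j)) → Σ j, T j :=
    fun j x y => ⟨j, (chartAt (EuclideanSpace ℝ (Fin (dj j))) x).symm y⟩
  let W : ∀ (j : J), T j → Set (EuclideanSpace ℝ (Fin (dj j))) :=
    fun j x => (chartAt (EuclideanSpace ℝ (Fin (dj j))) x).target
  have hW : ∀ j x, IsOpen (W j x) := fun j x => (chartAt _ x).open_target
  have hφ : ∀ j x, ContinuousOn (φ j x) (W j x) := fun j x =>
    continuous_sigmaMk.comp_continuousOn (chartAt _ x).continuousOn_symm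
  have hφinj : ∀ j x, Set.InjOn (φ j x) (W j x) := fun j x =>
    sigma_mk_injective.injOn.comp (chartAt _ x).symm.injOn (Set.mapsTo_univ _ _)
  have hlocal : ∀ (h : (Σ j, T j) → (Fin l → ℝ)) (j : J) (x : T j),
      ContMDiff (𝓡 (dj j)) 𝓘(ℝ, Fin l → ℝ) 1 (fun x : T j => h ⟨j, x⟩) →
        ContDiffOn ℝ 1 (h ∘ φ j x) (W j x) := fun h j x hh =>
    contMDiffOn_iff_contDiffOn.1 (hh.comp_contMDiffOn contMDiffOn_chart_symm)
  have hcover : ∀ j, ∃ s : Set (T j), s.Countable ∧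
      ⋃ x ∈ s, (chartAt (EuclideanSpace ℝ (Fin (dj j))) x).source = Set.univ := fun j =>
    TopologicalSpace.countable_cover_nhds fun x => chart_source_mem_nhds _ x
  choose s hs hsU using hcover
  let crit : ∀ (j : J), T j → Set (EuclideanSpace ℝ (Fin (dj j))) := fun j x =>
    {y ∈ W j x | ¬ Function.Surjective (fderiv ℝ (f ∘ φ j x) y)}
  have hfd : ∀ j x, ∀ y ∈ W j x,
      HasFDerivAt (f ∘ φ j x) (fderiv ℝ (f ∘ φ j x) y) y := fun j x y hy =>
    (((hlocal f j x (hf j)).contDiffAt ((hW j x).mem_nhds hy)).differentiableAt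
      one_ne_zero).hasFDerivAt
  have hnull : volume (⋃ j, ⋃ x ∈ s j, (f ∘ φ j x) '' crit j x) = 0 := by
    refine measure_iUnion_null fun j => (measure_biUnion_null_iff (hs j)).2 fun x _ => ?_
    have hdim := finrank_le_finrank_of_contDiffOn_of_injOn (hW j x)
      ⟨_, mem_chart_target _ x⟩ (hlocal (fn 0) j x (hfn_C1 0 j))
      ((hfn_inj 0).injOn.comp (hφinj j x) (Set.mapsTo_univ _ _))
    rw [Module.finrank_fin_fun] at hdim
    exact volume_image_eq_zero_of_not_surjective_fderiv hdim
      (fun y hy => hfd j x y hy.1) fun y hy => hy.2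
  refine measure_mono_null ?_ hnull
  rintro u ⟨t₁, t₂, hne, h₁, h₂⟩
  by_contra hu
  have hhit : ∀ t : Σ j, T j, f t = u → ∀ O : Set (Σ j, T j), IsOpen O → t ∈ O →
      ∀ᶠ n in Filter.atTop, ∃ t' ∈ O, fn n t' = u := by
    rintro ⟨j, t⟩ ht O hO htO
    obtain ⟨x, hx, htx⟩ := Set.mem_iUnion₂.1 (hsU j ▸ Set.mem_univ t)
    let c := chartAt (EuclideanSpace ℝ (Fin (dj j))) x
    have hy : c t ∈ W j x := c.map_source htx
    have hφy : φ j x (c t) = ⟨j, t⟩ := congrArg (Sigma.mk j) (c.left_inv htx)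
    have hsurj : Function.Surjective (fderiv ℝ (f ∘ φ j x) (c t)) := by
      by_contra hns
      refine hu (Set.mem_iUnion.2 ⟨j, Set.mem_iUnion₂.2 ⟨x, hx, c t, ⟨hy, hns⟩, ?_⟩⟩)
      rw [Function.comp_apply, hφy, ht]
    have hev := eventually_exists_eq_of_surjective_fderiv (fn := fun n => fn n ∘ φ j x)
      ((hφ j x).isOpen_inter_preimage (hW j x) hO)
      ⟨hy, show φ j x (c t) ∈ O by rwa [hφy]⟩ (hfd j x _ hy) hsurj
      (fun n => (hlocal (fn n) j x (hfn_C1 n j)).mono Set.inter_subset_left)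
      fun K hKV hK => ((hconv _ (hK.image_of_continuousOn ((hφ j x).mono
        (hKV.trans Set.inter_subset_left)))).comp (φ j x)).mono (Set.subset_preimage_image _ _)
    filter_upwards [hev] with n ⟨y, hyV, hyn⟩
    refine ⟨φ j x y, hyV.2, hyn.trans ?_⟩
    rw [Function.comp_apply, hφy, ht]
  obtain ⟨O₁, O₂, hO₁, hO₂, ht₁, ht₂, hdisj⟩ := t2_separation hne
  obtain ⟨n, ⟨a, ha, han⟩, b, hb, hbn⟩ :=
    ((hhit t₁ h₁ O₁ hO₁ ht₁).and (hhit t₂ h₂ O₂ hO₂ ht₂)).exists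
  exact hdisj.ne_of_mem ha hb (hfn_inj n (han.trans hbn.symm))
end

section
/- In the weak-identification limit objective setup, let π₁ ≠ π₂ ∈ Π be such that the d_h × d_β matrix A(π₁) − A(π₂) has rank d_h. If z = (z₁, z₂) ∈ ℝ^{d_β} × ℝ^{d_h} satisfies ∇_z(Q(π₁,z) − Q(π₂,z)) = 0, then both A(π₁)(z₁ − b) = z₂ − A(π₀)b and A(π₂)(z₁ − b) = z₂ − A(π₀)b hold. -/
open MeasureTheory Matrix

/-- The matrix `S(π) = H^{1/2}·(I_{d_β}; A(π))`: `H^{1/2}` times the identity stacked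
above `A(π)`. -/
noncomputable def weakIdS (dβ dh : ℕ)
    (Hhalf : Matrix (Fin (dβ + dh)) (Fin (dβ + dh)) ℝ)
    (A : Matrix (Fin dh) (Fin dβ) ℝ) : Matrix (Fin (dβ + dh)) (Fin dβ) ℝ :=
  Hhalf * Matrix.of (fun i j =>
    Fin.append (fun i' => (1 : Matrix (Fin dβ) (Fin dβ) ℝ) i' j) (fun i' => A i' j) i)

/-- The vector `g(π) = H^{1/2}·(0_{d_β}; A(π)b − A(π₀)b)`. -/
noncomputable def weakIdg (dβ dh : ℕ)
    (Hhalf : Matrix (Fin (dβ + dh)) (Fin (dβ + dh)) ℝ)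
    (A A₀ : Matrix (Fin dh) (Fin dβ) ℝ) (b : Fin dβ → ℝ) : Fin (dβ + dh) → ℝ :=
  Hhalf.mulVec (Fin.append (0 : Fin dβ → ℝ) (A.mulVec b - A₀.mulVec b))

/-- The weak-identification limit objective
`Q(π,z) = 2zᵀ(H^{1/2})ᵀg(π) − (H^{1/2}z + g(π))ᵀP(π)(H^{1/2}z + g(π)) + κ(π)`, where
`P(π) = S(π)(S(π)ᵀS(π))⁻¹S(π)ᵀ`. -/
noncomputable def weakIdQ (dβ dh : ℕ)
    (Hhalf : Matrix (Fin (dβ + dh)) (Fin (dβ + dh)) ℝ)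
    {Θ : Type*} (A : Θ → Matrix (Fin dh) (Fin dβ) ℝ) (π₀ : Θ) (b : Fin dβ → ℝ)
    (κ : Θ → ℝ) (π : Θ) (z : Fin (dβ + dh) → ℝ) : ℝ :=
  let g := weakIdg dβ dh Hhalf (A π) (A π₀) b
  let S := weakIdS dβ dh Hhalf (A π)
  let P : Matrix (Fin (dβ + dh)) (Fin (dβ + dh)) ℝ := S * (Sᵀ * S)⁻¹ * Sᵀ
  2 * (Hhalf.mulVec z ⬝ᵥ g) - ((Hhalf.mulVec z + g) ⬝ᵥ P.mulVec (Hhalf.mulVec z + g)) + κ π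

theorem isSymm_of_posDef {n : ℕ} {R : Matrix (Fin n) (Fin n) ℝ} (hR : R.PosDef) : R.IsSymm := by
  have h := hR.isHermitian.eq
  rwa [Matrix.conjTranspose_eq_transpose_of_trivial] at h

theorem weakIdS_mulVec (dβ dh : ℕ) (R : Matrix (Fin (dβ + dh)) (Fin (dβ + dh)) ℝ)
    (A : Matrix (Fin dh) (Fin dβ) ℝ) (c : Fin dβ → ℝ) :
    weakIdS dβ dh R A *ᵥ c = R *ᵥ Fin.append c (A *ᵥ c) := by
  rw [weakIdS, ← Matrix.mulVec_mulVec]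
  congr 1
  ext i
  refine Fin.addCases (fun i => ?_) (fun i => ?_) i
  · simp [Matrix.mulVec, dotProduct, Matrix.one_apply]
  · simp [Matrix.mulVec, dotProduct]

theorem mulVec_injective_of_posDef {n : ℕ} {R : Matrix (Fin n) (Fin n) ℝ} (hR : R.PosDef) :
    Function.Injective R.mulVec :=
  Matrix.mulVec_injective_of_isUnit hR.isUnit

theorem weakIdS_mulVec_injective {dβ dh : ℕ} {R : Matrix (Fin (dβ + dh)) (Fin (dβ + dh)) ℝ}
    (hR : R.PosDef) (A : Matrix (Fin dh) (Fin dβ) ℝ) :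
    Function.Injective (weakIdS dβ dh R A).mulVec := by
  intro c d h
  simp only [weakIdS_mulVec] at h
  have h' := mulVec_injective_of_posDef hR h
  ext i
  simpa using congrFun h' (Fin.castAdd dh i)

/-- The residual of the least-squares projection onto the columns of `S` is orthogonal to them. -/
theorem transpose_mulVec_sub_projection {m n : ℕ} {S : Matrix (Fin m) (Fin n) ℝ}
    (hS : Function.Injective S.mulVec) (u : Fin m → ℝ) :
    Sᵀ *ᵥ (u - (S * (Sᵀ * S)⁻¹ * Sᵀ) *ᵥ u) = 0 := by
  have hpd : (Sᵀ * S).PosDef := by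
    simpa [Matrix.conjTranspose_eq_transpose_of_trivial] using
      Matrix.PosDef.conjTranspose_mul_self S hS
  have hdet : IsUnit (Sᵀ * S).det := (Matrix.isUnit_iff_isUnit_det _).mp hpd.isUnit
  have h : Sᵀ * (S * (Sᵀ * S)⁻¹ * Sᵀ) = Sᵀ := by
    rw [← Matrix.mul_assoc, ← Matrix.mul_assoc, Matrix.mul_nonsing_inv _ hdet, Matrix.one_mul]
  rw [Matrix.mulVec_sub, Matrix.mulVec_mulVec, h, sub_self]

theorem projection_isSymm {m n : ℕ} (S : Matrix (Fin m) (Fin n) ℝ) :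
    (S * (Sᵀ * S)⁻¹ * Sᵀ).IsSymm := by
  simp [Matrix.IsSymm, Matrix.transpose_mul, Matrix.transpose_nonsing_inv, Matrix.mul_assoc]

theorem dotProduct_mulVec_comm_of_isSymm {n : ℕ} {P : Matrix (Fin n) (Fin n) ℝ}
    (hP : P.IsSymm) (x y : Fin n → ℝ) : x ⬝ᵥ P *ᵥ y = y ⬝ᵥ P *ᵥ x := by
  rw [Matrix.dotProduct_mulVec, ← Matrix.mulVec_transpose, hP.eq, dotProduct_comm]

theorem differentiable_weakIdQ (dβ dh : ℕ) (R : Matrix (Fin (dβ + dh)) (Fin (dβ + dh)) ℝ)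
    {Θ : Type*} (A : Θ → Matrix (Fin dh) (Fin dβ) ℝ) (π₀ : Θ) (b : Fin dβ → ℝ)
    (κ : Θ → ℝ) (π : Θ) : Differentiable ℝ (weakIdQ dβ dh R A π₀ b κ π) := by
  unfold weakIdQ
  simp only [dotProduct, Matrix.mulVec, Pi.add_apply]
  fun_prop

theorem hasDerivAt_weakIdQ_line (dβ dh : ℕ) (R : Matrix (Fin (dβ + dh)) (Fin (dβ + dh)) ℝ)
    {Θ : Type*} (A : Θ → Matrix (Fin dh) (Fin dβ) ℝ) (π₀ : Θ) (b : Fin dβ → ℝ)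
    (κ : Θ → ℝ) (π : Θ) (z h : Fin (dβ + dh) → ℝ) :
    let g := weakIdg dβ dh R (A π) (A π₀) b
    let S := weakIdS dβ dh R (A π)
    HasDerivAt (fun t : ℝ => weakIdQ dβ dh R A π₀ b κ π (z + t • h))
      (2 * (R *ᵥ h ⬝ᵥ (g - (S * (Sᵀ * S)⁻¹ * Sᵀ) *ᵥ (R *ᵥ z + g)))) 0 := by
  intro g S
  have hP := projection_isSymm S
  set P := S * (Sᵀ * S)⁻¹ * Sᵀ
  have hexp : (fun t : ℝ => weakIdQ dβ dh R A π₀ b κ π (z + t • h)) = fun t =>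
      weakIdQ dβ dh R A π₀ b κ π z + t * (2 * (R *ᵥ h ⬝ᵥ (g - P *ᵥ (R *ᵥ z + g))))
        - t ^ 2 * (R *ᵥ h ⬝ᵥ P *ᵥ (R *ᵥ h)) := by
    ext t
    have hu : R *ᵥ (z + t • h) + g = (R *ᵥ z + g) + t • R *ᵥ h := by
      rw [Matrix.mulVec_add, Matrix.mulVec_smul]; abel
    change 2 * (R *ᵥ (z + t • h) ⬝ᵥ g)
        - ((R *ᵥ (z + t • h) + g) ⬝ᵥ P *ᵥ (R *ᵥ (z + t • h) + g)) + κ π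
      = 2 * (R *ᵥ z ⬝ᵥ g) - ((R *ᵥ z + g) ⬝ᵥ P *ᵥ (R *ᵥ z + g)) + κ π + _ - _
    rw [hu, Matrix.mulVec_add R]
    generalize R *ᵥ z + g = u
    have hc := dotProduct_mulVec_comm_of_isSymm hP u (R *ᵥ h)
    simp only [Matrix.mulVec_add, Matrix.mulVec_smul, add_dotProduct, dotProduct_add,
      smul_dotProduct, dotProduct_smul, dotProduct_sub, smul_eq_mul, hc]
    ring
  rw [hexp]
  have h1 := (((hasDerivAt_id (0 : ℝ)).mul_const
    (2 * (R *ᵥ h ⬝ᵥ (g - P *ᵥ (R *ᵥ z + g))))).const_add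
      (weakIdQ dβ dh R A π₀ b κ π z)).sub
    (((hasDerivAt_id (0 : ℝ)).pow 2).mul_const (R *ᵥ h ⬝ᵥ P *ᵥ (R *ᵥ h)))
  refine h1.congr_deriv ?_
  simp

/-- A vector orthogonal to the columns of `S(π₁)` and `S(π₂)` vanishes when `A(π₁) - A(π₂)`
has full row rank. -/
theorem eq_zero_of_transpose_weakIdS_mulVec {dβ dh : ℕ}
    {R : Matrix (Fin (dβ + dh)) (Fin (dβ + dh)) ℝ} (hR : R.PosDef)
    {A₁ A₂ : Matrix (Fin dh) (Fin dβ) ℝ} (hrank : (A₁ - A₂).rank = dh)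
    {w : Fin (dβ + dh) → ℝ} (h₁ : (weakIdS dβ dh R A₁)ᵀ *ᵥ w = 0)
    (h₂ : (weakIdS dβ dh R A₂)ᵀ *ᵥ w = 0) : w = 0 := by
  have hsymm : R.IsSymm := isSymm_of_posDef hR
  have key : ∀ A : Matrix (Fin dh) (Fin dβ) ℝ, (weakIdS dβ dh R A)ᵀ *ᵥ w = 0 →
      ∀ c, Fin.append c (A *ᵥ c) ⬝ᵥ R *ᵥ w = 0 := by
    intro A hA c
    rw [dotProduct_mulVec_comm_of_isSymm hsymm, ← weakIdS_mulVec, Matrix.dotProduct_mulVec,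
      ← Matrix.mulVec_transpose, hA, zero_dotProduct]
  have hsplit : ∀ (c : Fin dβ → ℝ) (d : Fin dh → ℝ), Fin.append c d ⬝ᵥ R *ᵥ w =
      c ⬝ᵥ (fun i => (R *ᵥ w) (Fin.castAdd dh i)) +
        d ⬝ᵥ (fun i => (R *ᵥ w) (Fin.natAdd dβ i)) := by
    intro c d
    simp [dotProduct, Fin.sum_univ_add]
  have hsurj : Function.Surjective (A₁ - A₂).mulVec := by
    have : LinearMap.range (A₁ - A₂).mulVecLin = ⊤ := by
      apply Submodule.eq_top_of_finrank_eq
      rw [← Matrix.rank, hrank]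
      simp
    exact LinearMap.range_eq_top.mp this
  have hbot : (fun i => (R *ᵥ w) (Fin.natAdd dβ i)) = 0 := by
    obtain ⟨c, hc⟩ := hsurj (fun i => (R *ᵥ w) (Fin.natAdd dβ i))
    have e₁ := key A₁ h₁ c
    have e₂ := key A₂ h₂ c
    rw [hsplit] at e₁ e₂
    rw [← dotProduct_self_eq_zero]
    nth_rewrite 1 [← hc]
    rw [Matrix.sub_mulVec, sub_dotProduct]
    linarith
  have htop : (fun i => (R *ᵥ w) (Fin.castAdd dh i)) = 0 := by
    have e₁ := key A₁ h₁ (fun i => (R *ᵥ w) (Fin.castAdd dh i))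
    rw [hsplit, hbot, dotProduct_zero, add_zero] at e₁
    exact dotProduct_self_eq_zero.mp e₁
  apply mulVec_injective_of_posDef hR
  rw [Matrix.mulVec_zero]
  ext i
  exact Fin.addCases (fun i => congrFun htop i) (fun i => congrFun hbot i) i

theorem mulVec_sub_eq_of_eq_projection {dβ dh : ℕ}
    {R : Matrix (Fin (dβ + dh)) (Fin (dβ + dh)) ℝ} (hR : R.PosDef)
    {A A₀ : Matrix (Fin dh) (Fin dβ) ℝ} {b z₁ c : Fin dβ → ℝ} {z₂ : Fin dh → ℝ}
    (h : R *ᵥ Fin.append z₁ z₂ + weakIdg dβ dh R A A₀ b = weakIdS dβ dh R A *ᵥ c) :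
    A *ᵥ (z₁ - b) = z₂ - A₀ *ᵥ b := by
  rw [weakIdg, ← Matrix.mulVec_add, weakIdS_mulVec] at h
  have h' := mulVec_injective_of_posDef hR h
  have hc : z₁ = c := by
    ext i
    simpa using congrFun h' (Fin.castAdd dh i)
  subst hc
  ext i
  have hi := congrFun h' (Fin.natAdd dβ i)
  simp only [Pi.add_apply, Fin.append_right, Pi.sub_apply] at hi
  rw [Matrix.mulVec_sub, Pi.sub_apply, Pi.sub_apply]
  linarith

/-- gradient step in the proof of Theorem 4: if
`A(π₁) − A(π₂)` has rank `d_h` and the `z`-gradient of `Q(π₁,·) − Q(π₂,·)` vanishes at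
`z = (z₁, z₂)`, then both `A(π₁)(z₁−b) = z₂ − A(π₀)b` and `A(π₂)(z₁−b) = z₂ − A(π₀)b`. -/
theorem weakId_gradient_step (dβ dh : ℕ) (hdβ : 1 ≤ dβ) (hdh : 1 ≤ dh)
    {Θ : Type*}
    (H Hhalf : Matrix (Fin (dβ + dh)) (Fin (dβ + dh)) ℝ)
    (hHsymm : H.IsSymm) (hHpd : H.PosDef) (hHhalfpd : Hhalf.PosDef)
    (hHsq : Hhalf * Hhalf = H)
    (A : Θ → Matrix (Fin dh) (Fin dβ) ℝ) (π₀ : Θ) (b : Fin dβ → ℝ) (κ : Θ → ℝ)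
    (π₁ π₂ : Θ) (hππ : π₁ ≠ π₂) (hrank : (A π₁ - A π₂).rank = dh)
    (z₁ : Fin dβ → ℝ) (z₂ : Fin dh → ℝ)
    (hgrad : fderiv ℝ (fun z => weakIdQ dβ dh Hhalf A π₀ b κ π₁ z -
      weakIdQ dβ dh Hhalf A π₀ b κ π₂ z) (Fin.append z₁ z₂) = 0) :
    (A π₁).mulVec (z₁ - b) = z₂ - (A π₀).mulVec b ∧
    (A π₂).mulVec (z₁ - b) = z₂ - (A π₀).mulVec b := by
  have hsymm : Hhalf.IsSymm := isSymm_of_posDef hHhalfpd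
  set z := Fin.append z₁ z₂
  set g₁ := weakIdg dβ dh Hhalf (A π₁) (A π₀) b
  set g₂ := weakIdg dβ dh Hhalf (A π₂) (A π₀) b
  set S₁ := weakIdS dβ dh Hhalf (A π₁)
  set S₂ := weakIdS dβ dh Hhalf (A π₂)
  set P₁ := S₁ * (S₁ᵀ * S₁)⁻¹ * S₁ᵀ with hP₁
  set P₂ := S₂ * (S₂ᵀ * S₂)⁻¹ * S₂ᵀ with hP₂
  have hdir : ∀ h, Hhalf *ᵥ h ⬝ᵥ ((g₁ - P₁ *ᵥ (Hhalf *ᵥ z + g₁)) -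
      (g₂ - P₂ *ᵥ (Hhalf *ᵥ z + g₂))) = 0 := by
    intro h
    have hd : HasFDerivAt (fun z => weakIdQ dβ dh Hhalf A π₀ b κ π₁ z -
        weakIdQ dβ dh Hhalf A π₀ b κ π₂ z) 0 z :=
      hgrad ▸ (((differentiable_weakIdQ dβ dh Hhalf A π₀ b κ π₁).sub
        (differentiable_weakIdQ dβ dh Hhalf A π₀ b κ π₂)) z).hasFDerivAt
    have hline : HasDerivAt (fun t : ℝ => weakIdQ dβ dh Hhalf A π₀ b κ π₁ (z + t • h) -
        weakIdQ dβ dh Hhalf A π₀ b κ π₂ (z + t • h)) 0 0 := hd.hasLineDerivAt h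
    have heq := hline.unique ((hasDerivAt_weakIdQ_line dβ dh Hhalf A π₀ b κ π₁ z h).sub
      (hasDerivAt_weakIdQ_line dβ dh Hhalf A π₀ b κ π₂ z h))
    rw [dotProduct_sub]
    linarith
  have hdiff : (g₁ - P₁ *ᵥ (Hhalf *ᵥ z + g₁)) - (g₂ - P₂ *ᵥ (Hhalf *ᵥ z + g₂)) = 0 := by
    apply mulVec_injective_of_posDef hHhalfpd
    rw [Matrix.mulVec_zero, ← dotProduct_self_eq_zero,
      dotProduct_mulVec_comm_of_isSymm hsymm, dotProduct_comm]
    exact hdir _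
  have hres : Hhalf *ᵥ z + g₁ - P₁ *ᵥ (Hhalf *ᵥ z + g₁) =
      Hhalf *ᵥ z + g₂ - P₂ *ᵥ (Hhalf *ᵥ z + g₂) := by
    rw [add_sub_assoc, add_sub_assoc, sub_eq_zero.mp hdiff]
  have h₁ := transpose_mulVec_sub_projection
    (weakIdS_mulVec_injective hHhalfpd (A π₁)) (Hhalf *ᵥ z + g₁)
  have h₂ := transpose_mulVec_sub_projection
    (weakIdS_mulVec_injective hHhalfpd (A π₂)) (Hhalf *ᵥ z + g₂)
  have hzero : Hhalf *ᵥ z + g₁ - P₁ *ᵥ (Hhalf *ᵥ z + g₁) = 0 :=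
    eq_zero_of_transpose_weakIdS_mulVec hHhalfpd hrank h₁ (hres ▸ h₂)
  have hzero' := hres ▸ hzero
  rw [sub_eq_zero, hP₁, Matrix.mul_assoc, ← Matrix.mulVec_mulVec] at hzero
  rw [sub_eq_zero, hP₂, Matrix.mul_assoc, ← Matrix.mulVec_mulVec] at hzero'
  exact ⟨mulVec_sub_eq_of_eq_projection hHhalfpd hzero,
    mulVec_sub_eq_of_eq_projection hHhalfpd hzero'⟩
end
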